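/- arXiv:0805.0016 — 2 statements merged into one kernel-verified Lean document; each statement's English description precedes it below -/
import Mathlib

section
/- There is a constant c > 0 such that for every positive integer n divisible by 3 and every 3-decomposable set P of n points in general position in the plane, the number cr(P) of 4-element subsets of P in convex position satisfies cr(P) ≥ (2/27)·(15 − π²)·binom(n,4) − c·n³. (Note that (2/27)(15 − π²) > 0.380029.) -/
/-- Dot product of two planar vectors. -/
def dot (p v : ℝ × ℝ) : ℝ := p.1 * v.1 + p.2 * v.2

/-- A finite planar point set is in general position if no three of its points are collinear. -/
def GenPos (P : Finset (ℝ × ℝ)) : Prop :=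
  ∀ p ∈ P, ∀ q ∈ P, ∀ r ∈ P, p ≠ q → p ≠ r → q ≠ r →
    ¬ Collinear ℝ ({p, q, r} : Set (ℝ × ℝ))

/-- A set of points is in convex position if no point lies in the convex hull of the others. -/
def ConvexPos (S : Set (ℝ × ℝ)) : Prop :=
  ∀ p ∈ S, p ∉ convexHull ℝ (S \ {p})

/-- `crNum P` is the number of 4-element subsets of `P` in convex position,
i.e. the number of crossings of the straight-line drawing of the complete graph on `P`. -/
noncomputable def crNum (P : Finset (ℝ × ℝ)) : ℕ :=
  Set.ncard {Q : Finset (ℝ × ℝ) | Q ⊆ P ∧ Q.card = 4 ∧ ConvexPos (↑Q : Set (ℝ × ℝ))}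

/-- A finite planar point set `P` (of cardinality divisible by 3) is 3-decomposable if it can be
partitioned into three equal-size parts `A`, `B`, `C` and there are three pairwise non-parallel
nonzero directions `v₁, v₂, v₃` such that the projections onto these directions show `A` between
`B` and `C`, `B` between `A` and `C`, and `C` between `A` and `B`, respectively. -/
def ThreeDecompPts (P : Finset (ℝ × ℝ)) : Prop :=
  ∃ A B C : Finset (ℝ × ℝ),
    Disjoint A B ∧ Disjoint A C ∧ Disjoint B C ∧ A ∪ B ∪ C = P ∧
    3 * A.card = P.card ∧ 3 * B.card = P.card ∧ 3 * C.card = P.card ∧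
    ∃ v₁ v₂ v₃ : ℝ × ℝ, v₁ ≠ 0 ∧ v₂ ≠ 0 ∧ v₃ ≠ 0 ∧
      (∀ t : ℝ, v₂ ≠ t • v₁) ∧ (∀ t : ℝ, v₃ ≠ t • v₁) ∧ (∀ t : ℝ, v₃ ≠ t • v₂) ∧
      ∀ a ∈ A, ∀ b ∈ B, ∀ c ∈ C,
        dot b v₁ < dot a v₁ ∧ dot a v₁ < dot c v₁ ∧
        dot a v₂ < dot b v₂ ∧ dot b v₂ < dot c v₂ ∧
        dot a v₃ < dot c v₃ ∧ dot c v₃ < dot b v₃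

/-- Twice the signed area of the triangle `pqr`. -/
def orient (p q r : ℝ × ℝ) : ℝ :=
  (q.1 - p.1) * (r.2 - p.2) - (q.2 - p.2) * (r.1 - p.1)

/-- The number of points of `P` strictly to the left of the directed line `pq`. -/
noncomputable def leftCount (P : Finset (ℝ × ℝ)) (p q : ℝ × ℝ) : ℕ :=
  (P.filter fun r => 0 < orient p q r).card

/-- The number of points of `P` strictly below `a` in direction `v`. -/
noncomputable def rank (P : Finset (ℝ × ℝ)) (v a : ℝ × ℝ) : ℕ :=
  (P.filter fun p => dot p v < dot a v).card

lemma orient_swap (p q r : ℝ × ℝ) : orient q p r = -orient p q r := by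
  simp only [orient]; ring

lemma collinear_of_orient_eq_zero {p q r : ℝ × ℝ} (h : orient p q r = 0) :
    Collinear ℝ ({p, q, r} : Set (ℝ × ℝ)) := by
  by_cases hpq : q = p
  · subst hpq
    simpa using collinear_pair ℝ q r
  rw [collinear_iff_of_mem (p₀ := p) (by simp)]
  refine ⟨q - p, ?_⟩
  have hne : q.1 - p.1 ≠ 0 ∨ q.2 - p.2 ≠ 0 := by
    by_contra! hc
    exact hpq (Prod.ext (by linarith [hc.1]) (by linarith [hc.2]))
  simp only [orient] at h
  intro x hx
  simp only [Set.mem_insert_iff, Set.mem_singleton_iff] at hx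
  rcases hx with rfl | rfl | rfl
  · exact ⟨0, by simp⟩
  · exact ⟨1, by simp⟩
  · rcases hne with hne | hne
    · refine ⟨(x.1 - p.1) / (q.1 - p.1), Prod.ext ?_ ?_⟩
      · simp; field_simp; ring
      · simp; field_simp; linarith
    · refine ⟨(x.2 - p.2) / (q.2 - p.2), Prod.ext ?_ ?_⟩
      · simp; field_simp; linarith
      · simp; field_simp; ring

lemma GenPos.orient_ne_zero {P : Finset (ℝ × ℝ)} (hP : GenPos P) {p q r : ℝ × ℝ}
    (hp : p ∈ P) (hq : q ∈ P) (hr : r ∈ P) (hpq : p ≠ q) (hpr : p ≠ r) (hqr : q ≠ r) :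
    orient p q r ≠ 0 :=
  fun h => hP p hp q hq r hr hpq hpr hqr (collinear_of_orient_eq_zero h)

lemma leftCount_add_leftCount {P : Finset (ℝ × ℝ)} (hP : GenPos P) {p q : ℝ × ℝ}
    (hp : p ∈ P) (hq : q ∈ P) (hpq : p ≠ q) :
    leftCount P p q + leftCount P q p + 2 = P.card := by
  have h1 : leftCount P p q + leftCount P q p = ((P.erase p).erase q).card := by
    unfold leftCount
    rw [← Finset.card_union_of_disjoint]
    · congr 1
      ext r
      simp only [Finset.mem_union, Finset.mem_filter, Finset.mem_erase]
      rw [orient_swap p q]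
      constructor
      · rintro (⟨h, h'⟩ | ⟨h, h'⟩) <;>
        · refine ⟨?_, ?_, h⟩ <;> rintro rfl <;> simp only [orient] at h' <;> linarith
      · rintro ⟨h1, h2, h3⟩
        rcases lt_or_gt_of_ne (hP.orient_ne_zero hp hq h3 hpq h2.symm h1.symm) with h | h
        · exact Or.inr ⟨h3, by linarith⟩
        · exact Or.inl ⟨h3, h⟩
    · rw [Finset.disjoint_filter]
      intro r _ h
      rw [orient_swap p q]; linarith
  have hq' : q ∈ P.erase p := Finset.mem_erase.2 ⟨hpq.symm, hq⟩
  have h2 := Finset.card_erase_add_one hq'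
  have h3 := Finset.card_erase_add_one hp
  omega

lemma sum_telescope_of_injOn {ι : Type*} (S : Finset ι) (t : ι → ℝ) (ht : Set.InjOn t S)
    (ε : ι → ℤ) (G : ℤ → ℝ) (r : ℤ) :
    ∑ p ∈ S, (G (r + ((∑ q ∈ S with t q < t p, ε q) + ε p)) - G (r + ∑ q ∈ S with t q < t p, ε q))
      = G (r + ∑ q ∈ S, ε q) - G r := by
  classical
  induction S using Finset.induction_on_max_value t with
  | empty => simp
  | insert a s ha hmax ih =>
    have hlt : ∀ x ∈ s, t x < t a := fun x hx => lt_of_le_of_ne (hmax x hx) fun h => ha <| by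
      rwa [← ht (by simp [hx]) (by simp) h]
    rw [Finset.sum_insert ha]
    have e1 : (insert a s).filter (fun q => t q < t a) = s := by
      ext x
      simp only [Finset.mem_filter, Finset.mem_insert]
      constructor
      · rintro ⟨rfl | h, h'⟩
        · exact absurd h' (lt_irrefl _)
        · exact h
      · exact fun h => ⟨Or.inr h, hlt x h⟩
    have e2 : ∀ p ∈ s, (insert a s).filter (fun q => t q < t p) = s.filter (fun q => t q < t p) := by
      intro p hp
      rw [Finset.filter_insert, if_neg (not_lt.2 (hmax p hp))]
    have e3 : ∑ p ∈ s, (G (r + ((∑ q ∈ insert a s with t q < t p, ε q) + ε p))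
        - G (r + ∑ q ∈ insert a s with t q < t p, ε q)) = G (r + ∑ q ∈ s, ε q) - G r := by
      rw [← ih (ht.mono (by simp))]
      exact Finset.sum_congr rfl fun p hp => by rw [e2 p hp]
    rw [e1, e3, Finset.sum_insert ha, add_comm (ε a)]
    ring

/-- Sweep a directed line through `a` by a half-turn, starting with normal direction `v`: each
other point of `P` is passed exactly once, and the number of points below `a` performs a
`±1` walk from `rank P v a` to `P.card - 1 - rank P v a`. -/
lemma sum_halfturn {P : Finset (ℝ × ℝ)} (hP : GenPos P) {v : ℝ × ℝ}
    (hv : Set.InjOn (fun p => dot p v) P) {a : ℝ × ℝ} (ha : a ∈ P) (G : ℤ → ℝ)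
    (hG : ∀ k : ℤ, G (P.card - 1 - k) - G (P.card - 2 - k) = G (k + 1) - G k) :
    ∑ p ∈ P.erase a, (if dot a v < dot p v then (1 : ℝ) else -1) *
        (G (leftCount P a p + 1) - G (leftCount P a p))
      = G (P.card - 1 - rank P v a) - G (rank P v a) := by
  set X : ℝ × ℝ → ℝ := fun p => dot p v - dot a v with hX
  set Y : ℝ × ℝ → ℝ := fun p => (p.2 - a.2) * v.1 - (p.1 - a.1) * v.2 with hY
  set S := P.erase a with hS
  have hX0 : ∀ p ∈ S, X p ≠ 0 := fun p hp h => (Finset.mem_erase.1 hp).1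
    (hv (Finset.mem_erase.1 hp).2 ha (by simp only [hX] at h; simp only; linarith))
  have hcross : ∀ p q, X p * Y q - Y p * X q = (v.1 ^ 2 + v.2 ^ 2) * orient a p q := by
    intro p q; simp only [hX, hY, dot, orient]; ring
  have hvpos : ∀ p ∈ S, 0 < v.1 ^ 2 + v.2 ^ 2 := by
    intro p hp
    by_contra! h
    have h1 : v.1 = 0 := by nlinarith [sq_nonneg v.1, sq_nonneg v.2]
    have h2 : v.2 = 0 := by nlinarith [sq_nonneg v.1, sq_nonneg v.2]
    exact hX0 p hp (by simp [hX, dot, h1, h2])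
  set t : ℝ × ℝ → ℝ := fun p => Y p / X p with ht
  have ht_inj : Set.InjOn t S := by
    intro p hp q hq h
    by_contra hne
    have hp' := Finset.mem_coe.1 hp
    have hq' := Finset.mem_coe.1 hq
    simp only [ht] at h
    rw [div_eq_div_iff (hX0 p hp') (hX0 q hq')] at h
    have h1 := hcross p q
    have h2 := hP.orient_ne_zero ha (Finset.mem_erase.1 hp').2 (Finset.mem_erase.1 hq').2
      (Finset.mem_erase.1 hp').1.symm (Finset.mem_erase.1 hq').1.symm hne
    have h3 := (hvpos p hp').ne'
    exact mul_ne_zero h3 h2 (by rw [← h1]; linarith)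
  set ε : ℝ × ℝ → ℤ := fun p => if 0 < X p then 1 else -1 with hε
  have hrank : rank P v a = (S.filter fun p => X p < 0).card := by
    unfold rank
    congr 1
    ext p
    simp only [hS, Finset.mem_filter, Finset.mem_erase, hX, sub_neg]
    constructor
    · rintro ⟨h, h'⟩
      exact ⟨⟨by rintro rfl; exact lt_irrefl _ h', h⟩, h'⟩
    · rintro ⟨⟨_, h⟩, h'⟩
      exact ⟨h, h'⟩
  have hεsum : ∀ s : Finset (ℝ × ℝ), s ⊆ S → ∑ p ∈ s, ε p =
      (s.filter fun p => 0 < X p).card - (s.filter fun p => X p < 0).card := by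
    intro s hs
    rw [Finset.card_filter, Finset.card_filter]
    push_cast
    rw [← Finset.sum_sub_distrib]
    refine Finset.sum_congr rfl fun p hp => ?_
    rcases lt_or_gt_of_ne (hX0 p (hs hp)) with h | h
    · simp [hε, h, not_lt.2 h.le]
    · simp [hε, h, not_lt.2 h.le]
  have hScard : (S.card : ℤ) = P.card - 1 := by
    have := Finset.card_erase_add_one ha
    rw [hS]; omega
  have hfin : (rank P v a : ℤ) + ∑ p ∈ S, ε p = P.card - 1 - rank P v a := by
    rw [hεsum S subset_rfl, ← hScard, hrank]
    have h := Finset.card_filter_add_card_filter_not (s := S) (fun p => X p < 0)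
    have h2 : S.filter (fun p => ¬ X p < 0) = S.filter (fun p => 0 < X p) :=
      Finset.filter_congr fun p hp => ⟨fun h => lt_of_le_of_ne (not_lt.1 h) (hX0 p hp).symm,
        fun h => not_lt.2 h.le⟩
    rw [h2] at h
    omega
  rw [← hfin, ← sum_telescope_of_injOn S t ht_inj ε G (rank P v a)]
  refine Finset.sum_congr rfl fun p hp => ?_
  have hpP := (Finset.mem_erase.1 hp).2
  have hpa := (Finset.mem_erase.1 hp).1
  have hlr := leftCount_add_leftCount hP ha hpP hpa.symm
  -- the number of points below the line `ap` when it is passed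
  have hbelow : ((S.filter fun q => X p * (X p * Y q - Y p * X q) < 0).card : ℤ)
      + (if 0 < X p then 0 else 1) = rank P v a + ∑ q ∈ S with t q < t p, ε q := by
    have hsign : ∀ q ∈ S, X p * (X p * Y q - Y p * X q) < 0 ↔
        (0 < X q ∧ t q < t p) ∨ (X q < 0 ∧ t p < t q) := by
      intro q hq
      have h1 : X p * (X p * Y q - Y p * X q) = (X p) ^ 2 * (X q * (t q - t p)) := by
        have := hX0 p hp
        have := hX0 q hq
        simp only [ht]; field_simp
      have h2 : 0 < (X p) ^ 2 := by have := hX0 p hp; positivity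
      rw [h1, mul_neg_iff]
      simp only [h2, true_and, not_lt.2 h2.le, false_and, or_false, mul_neg_iff, sub_neg, sub_pos]
    rw [hrank, hεsum _ (Finset.filter_subset _ _), Finset.filter_congr hsign, Finset.filter_or,
      Finset.card_union_of_disjoint (by
        rw [Finset.disjoint_filter]
        rintro q _ ⟨h, _⟩ ⟨h', _⟩
        linarith), Finset.filter_filter, Finset.filter_filter]
    have e1 : (S.filter fun q => X q < 0).card = (S.filter fun q => X q < 0 ∧ t p < t q).card
        + (S.filter fun q => t q < t p ∧ X q < 0).card + (if 0 < X p then 0 else 1) := by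
      have e2 : (if 0 < X p then 0 else 1) = (S.filter fun q => q = p ∧ X q < 0).card := by
        split_ifs with h
        · symm
          rw [Finset.card_eq_zero, Finset.filter_eq_empty_iff]
          rintro q _ ⟨rfl, h'⟩
          linarith
        · symm
          rw [Finset.card_eq_one]
          refine ⟨p, ?_⟩
          ext q
          simp only [Finset.mem_filter, Finset.mem_singleton]
          constructor
          · exact fun h => h.2.1
          · rintro rfl
            exact ⟨hp, rfl, lt_of_le_of_ne (not_lt.1 h) (hX0 q hp)⟩
      rw [e2, ← Finset.card_union_of_disjoint, ← Finset.card_union_of_disjoint]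
      · congr 1
        ext q
        simp only [Finset.mem_filter, Finset.mem_union]
        constructor
        · rintro ⟨h, h'⟩
          rcases lt_trichotomy (t p) (t q) with h3 | h3 | h3
          · exact Or.inl (Or.inl ⟨h, h', h3⟩)
          · exact Or.inr ⟨h, (ht_inj hp h h3).symm, h'⟩
          · exact Or.inl (Or.inr ⟨h, h3, h'⟩)
        · rintro ((⟨h, h', _⟩ | ⟨h, _, h'⟩) | ⟨h, _, h'⟩) <;> exact ⟨h, h'⟩
      · rw [Finset.disjoint_left]
        intro q hq hq'
        simp only [Finset.mem_filter, Finset.mem_union] at hq hq'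
        obtain ⟨_, rfl, _⟩ := hq'
        rcases hq with ⟨_, _, h⟩ | ⟨_, h, _⟩ <;> exact lt_irrefl _ h
      · rw [Finset.disjoint_filter]
        rintro q _ ⟨_, h⟩ ⟨h', _⟩
        exact lt_asymm h h'
    have e3 : (S.filter fun q => 0 < X q ∧ t q < t p) = S.filter fun q => t q < t p ∧ 0 < X q :=
      Finset.filter_congr fun q _ => and_comm
    rw [e3, e1]
    push_cast
    ring
  have hvp := hvpos p hp
  have hfilter : ∀ b : ℝ × ℝ → Prop, (∀ q, b q → q ≠ a) → ∀ [DecidablePred b],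
      S.filter b = P.filter b := by
    intro b hb _
    ext q
    simp only [hS, Finset.mem_filter, Finset.mem_erase]
    exact ⟨fun h => ⟨h.1.2, h.2⟩, fun h => ⟨⟨hb q h.2, h.1⟩, h.2⟩⟩
  have hoa : ∀ q, orient a p q ≠ 0 → q ≠ a := by
    rintro q h rfl
    exact h (by simp [orient])
  by_cases hXp : 0 < X p
  · have h1 : (S.filter fun q => X p * (X p * Y q - Y p * X q) < 0).card = leftCount P p a := by
      unfold leftCount
      rw [← hfilter _ (fun q h => hoa q (by rw [orient_swap a p] at h; linarith))]
      congr 1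
      refine Finset.filter_congr fun q _ => ?_
      rw [hcross, orient_swap a p, ← mul_assoc, mul_neg_iff]
      have : 0 < X p * (v.1 ^ 2 + v.2 ^ 2) := by positivity
      simp [this, not_lt.2 this.le]
    rw [h1] at hbelow
    simp only [hXp, if_true, add_zero] at hbelow
    have hεp : ε p = 1 := by simp [hε, hXp]
    have h2 : dot a v < dot p v := by simpa [hX] using hXp
    rw [← add_assoc, ← hbelow, hεp, if_pos h2, one_mul, ← hG]
    congr 2 <;> omega
  · have hXp' : X p < 0 := lt_of_le_of_ne (not_lt.1 hXp) (hX0 p hp)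
    have h1 : (S.filter fun q => X p * (X p * Y q - Y p * X q) < 0).card = leftCount P a p := by
      unfold leftCount
      rw [← hfilter _ (fun q h => hoa q (by linarith))]
      congr 1
      refine Finset.filter_congr fun q _ => ?_
      rw [hcross, ← mul_assoc, mul_neg_iff]
      have : X p * (v.1 ^ 2 + v.2 ^ 2) < 0 := by nlinarith
      simp [this, not_lt.2 this.le]
    rw [h1] at hbelow
    simp only [hXp, if_false] at hbelow
    have hεp : ε p = -1 := by simp [hε, hXp]
    have h2 : ¬ dot a v < dot p v := by simpa [hX] using hXp
    rw [← add_assoc, ← hbelow, hεp, if_neg h2]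
    rw [show (leftCount P a p : ℤ) + 1 + -1 = leftCount P a p by ring]
    ring

lemma orient_of_mem_convexHull {p q r s : ℝ × ℝ}
    (h : p ∈ convexHull ℝ ({q, r, s} : Set (ℝ × ℝ))) :
    0 ≤ orient p r s * orient q r s ∧ 0 ≤ orient q p s * orient q r s ∧
      0 ≤ orient q r p * orient q r s := by
  rw [convexHull_insert (by simp), convexHull_pair, mem_convexJoin] at h
  obtain ⟨x, hx, y, hy, hp⟩ := h
  rw [Set.mem_singleton_iff] at hx
  subst hx
  obtain ⟨α, β, hα, hβ, hαβ, rfl⟩ := hy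
  obtain ⟨γ, δ, hγ, hδ, hγδ, rfl⟩ := hp
  obtain rfl : β = 1 - α := by linarith
  obtain rfl : γ = 1 - δ := by linarith
  refine ⟨?_, ?_, ?_⟩
  · have : orient ((1 - δ) • x + δ • (α • r + (1 - α) • s)) r s = (1 - δ) * orient x r s := by
      simp [orient]; ring
    rw [this, mul_assoc]
    exact mul_nonneg hγ (mul_self_nonneg _)
  · have : orient x ((1 - δ) • x + δ • (α • r + (1 - α) • s)) s = (δ * α) * orient x r s := by
      simp [orient]; ring
    rw [this, mul_assoc]
    exact mul_nonneg (mul_nonneg hδ hα) (mul_self_nonneg _)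
  · have : orient x r ((1 - δ) • x + δ • (α • r + (1 - α) • s)) = (δ * (1 - α)) * orient x r s := by
      simp [orient]; ring
    rw [this, mul_assoc]
    exact mul_nonneg (mul_nonneg hδ hβ) (mul_self_nonneg _)

/-- The line `pq` separates `r` from `s`. -/
def Separates (p q r s : ℝ × ℝ) : Prop := orient p q r * orient p q s < 0

open Classical in
/-- Among the six pairs of a four-point set in general position, at least two (and at least three
if the set is not in convex position) span a line that separates the other two points. -/
lemma three_le_separating_pairs {a b c d : ℝ × ℝ} (hab : a ≠ b) (hac : a ≠ c) (had : a ≠ d)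
    (hbc : b ≠ c) (hbd : b ≠ d) (hcd : c ≠ d) (h1 : orient b c d ≠ 0) (h2 : orient a c d ≠ 0)
    (h3 : orient a b d ≠ 0) (h4 : orient a b c ≠ 0) :
    3 ≤ (if Separates a b c d then 1 else 0) + (if Separates a c b d then 1 else 0)
      + (if Separates a d b c then 1 else 0) + (if Separates b c a d then 1 else 0)
      + (if Separates b d a c then 1 else 0) + (if Separates c d a b then 1 else 0)
      + (if ConvexPos ({a, b, c, d} : Set (ℝ × ℝ)) then 1 else 0) := by
  have hsum : orient b c d - orient a c d + orient a b d - orient a b c = 0 := by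
    simp only [orient]; ring
  have e1 : orient a c b = -orient a b c := by simp only [orient]; ring
  have e2 : orient a d b = -orient a b d := by simp only [orient]; ring
  have e3 : orient a d c = -orient a c d := by simp only [orient]; ring
  have e4 : orient b c a = orient a b c := by simp only [orient]; ring
  have e5 : orient b d a = orient a b d := by simp only [orient]; ring
  have e6 : orient b d c = -orient b c d := by simp only [orient]; ring
  have e7 : orient c d a = orient a c d := by simp only [orient]; ring
  have e8 : orient c d b = orient b c d := by simp only [orient]; ring
  have e9 : orient b a d = -orient a b d := by simp only [orient]; ring
  have hconv : ¬ ConvexPos ({a, b, c, d} : Set (ℝ × ℝ)) →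
      (0 < orient b c d * orient a c d ∧ orient b c d * orient a b d < 0 ∧
        0 < orient b c d * orient a b c) ∨
      (0 < orient a c d * orient b c d ∧ 0 < orient a c d * orient a b d ∧
        orient a c d * orient a b c < 0) ∨
      (orient a b d * orient b c d < 0 ∧ 0 < orient a b d * orient a c d ∧
        0 < orient a b d * orient a b c) ∨
      (0 < orient a b c * orient b c d ∧ orient a b c * orient a c d < 0 ∧
        0 < orient a b c * orient a b d) := by
    intro h
    unfold ConvexPos at h
    push Not at h
    obtain ⟨p, hp, hp'⟩ := h
    have hpos : ∀ {x y : ℝ}, x ≠ 0 → y ≠ 0 → 0 ≤ x * y → 0 < y * x := fun hx hy h =>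
      lt_of_le_of_ne (by rwa [mul_comm]) (mul_ne_zero hy hx).symm
    have hneg : ∀ {x y : ℝ}, x ≠ 0 → y ≠ 0 → 0 ≤ -x * y → y * x < 0 := fun hx hy h =>
      lt_of_le_of_ne (by linarith) (mul_ne_zero hy hx)
    simp only [Set.mem_insert_iff, Set.mem_singleton_iff] at hp
    rcases hp with rfl | rfl | rfl | rfl
    · have hs : ({p, b, c, d} : Set (ℝ × ℝ)) \ {p} = {b, c, d} := by
        ext x; simp; grind
      rw [hs] at hp'
      obtain ⟨k1, k2, k3⟩ := orient_of_mem_convexHull hp'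
      rw [e9] at k2
      rw [e4] at k3
      exact Or.inl ⟨hpos h2 h1 k1, hneg h3 h1 k2, hpos h4 h1 k3⟩
    · have hs : ({a, p, c, d} : Set (ℝ × ℝ)) \ {p} = {a, c, d} := by
        ext x; simp; grind
      rw [hs] at hp'
      obtain ⟨k1, k2, k3⟩ := orient_of_mem_convexHull hp'
      rw [e1] at k3
      exact Or.inr (Or.inl ⟨hpos h1 h2 k1, hpos h3 h2 k2, hneg h4 h2 k3⟩)
    · have hs : ({a, b, p, d} : Set (ℝ × ℝ)) \ {p} = {a, b, d} := by
        ext x; simp; grind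
      rw [hs] at hp'
      obtain ⟨k1, k2, k3⟩ := orient_of_mem_convexHull hp'
      rw [show orient p b d = -orient b p d by simp only [orient]; ring] at k1
      exact Or.inr (Or.inr (Or.inl ⟨hneg h1 h3 k1, hpos h2 h3 k2, hpos h4 h3 k3⟩))
    · have hs : ({a, b, c, p} : Set (ℝ × ℝ)) \ {p} = {a, b, c} := by
        ext x; simp; grind
      rw [hs] at hp'
      obtain ⟨k1, k2, k3⟩ := orient_of_mem_convexHull hp'
      rw [show orient p b c = orient b c p by simp only [orient]; ring] at k1
      rw [show orient a p c = -orient a c p by simp only [orient]; ring] at k2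
      exact Or.inr (Or.inr (Or.inr ⟨hpos h1 h4 k1, hneg h2 h4 k2, hpos h3 h4 k3⟩))
  simp only [Separates, e1, e2, e3, e4, e5, e6, e7, e8]
  clear e1 e2 e3 e4 e5 e6 e7 e8 e9
  by_cases hc : ConvexPos ({a, b, c, d} : Set (ℝ × ℝ))
  · simp only [hc, if_true]
    rcases lt_or_gt_of_ne h1 with hA | hA <;> rcases lt_or_gt_of_ne h2 with hB | hB <;>
      rcases lt_or_gt_of_ne h3 with hC | hC <;> rcases lt_or_gt_of_ne h4 with hD | hD <;>
      first
      | (exfalso; linarith)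
      | simp [mul_neg_iff, mul_pos_iff, hA, hB, hC, hD,
          not_lt.2 hA.le, not_lt.2 hB.le, not_lt.2 hC.le, not_lt.2 hD.le]
  · have hconv := hconv hc
    rcases lt_or_gt_of_ne h1 with hA | hA <;> rcases lt_or_gt_of_ne h2 with hB | hB <;>
      rcases lt_or_gt_of_ne h3 with hC | hC <;> rcases lt_or_gt_of_ne h4 with hD | hD <;>
      simp_all [mul_neg_iff, mul_pos_iff,
        not_lt.2 hA.le, not_lt.2 hB.le, not_lt.2 hC.le, not_lt.2 hD.le]

open Classical in
/-- Ordered quadruples of pairwise distinct elements of `S`. -/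
noncomputable def distinctQuads {α : Type*} (S : Finset α) : Finset (α × α × α × α) :=
  (S ×ˢ S ×ˢ S ×ˢ S).filter fun x => x.1 ≠ x.2.1 ∧ x.1 ≠ x.2.2.1 ∧ x.1 ≠ x.2.2.2 ∧
    x.2.1 ≠ x.2.2.1 ∧ x.2.1 ≠ x.2.2.2 ∧ x.2.2.1 ≠ x.2.2.2

lemma card_distinctQuads {α : Type*} (S : Finset α) :
    (distinctQuads S).card = S.card * (S.card - 1) * (S.card - 2) * (S.card - 3) := by
  classical
  have key : ∀ (a : α) (U : Finset α), a ∈ U → (U.filter fun x => a ≠ x).card = U.card - 1 := by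
    intro a U ha
    rw [← Finset.card_erase_of_mem ha]
    congr 1
    ext x
    simp [and_comm, eq_comm]
  unfold distinctQuads
  rw [Finset.card_filter]
  simp only [Finset.sum_product]
  have h3 : ∀ a ∈ S, ∀ b ∈ S, ∀ c ∈ S, ∑ d ∈ S, (if a ≠ b ∧ a ≠ c ∧ a ≠ d ∧ b ≠ c ∧ b ≠ d ∧ c ≠ d
      then 1 else 0) = if a ≠ b ∧ a ≠ c ∧ b ≠ c then S.card - 3 else 0 := by
    intro a ha b hb c hc
    split_ifs with h
    · obtain ⟨hab, hac, hbc⟩ := h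
      rw [← Finset.card_filter]
      have : S.filter (fun d => a ≠ b ∧ a ≠ c ∧ a ≠ d ∧ b ≠ c ∧ b ≠ d ∧ c ≠ d) =
          ((S.filter fun x => a ≠ x).filter fun x => b ≠ x).filter fun x => c ≠ x := by
        ext x; simp [hab, hac, hbc]; tauto
      rw [this, key c _ (by simp [*]), key b _ (by simp [*]), key a _ ha]
      omega
    · refine Finset.sum_eq_zero fun d _ => if_neg fun h' => h ⟨h'.1, h'.2.1, h'.2.2.2.1⟩
  have h2 : ∀ a ∈ S, ∀ b ∈ S, ∑ c ∈ S, (if a ≠ b ∧ a ≠ c ∧ b ≠ c then S.card - 3 else 0) =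
      if a ≠ b then (S.card - 2) * (S.card - 3) else 0 := by
    intro a ha b hb
    split_ifs with h
    · rw [← Finset.sum_filter, Finset.sum_const, smul_eq_mul]
      have : S.filter (fun c => a ≠ b ∧ a ≠ c ∧ b ≠ c) =
          (S.filter fun x => a ≠ x).filter fun x => b ≠ x := by
        ext x; simp [h]; tauto
      rw [this, key b _ (by simp [*]), key a _ ha]
      congr 1
    · exact Finset.sum_eq_zero fun d _ => if_neg fun h' => h h'.1
  have h1 : ∀ a ∈ S, ∑ b ∈ S, (if a ≠ b then (S.card - 2) * (S.card - 3) else 0) =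
      (S.card - 1) * ((S.card - 2) * (S.card - 3)) := by
    intro a ha
    rw [← Finset.sum_filter, Finset.sum_const, smul_eq_mul, key a _ ha]
  rw [Finset.sum_congr rfl fun a ha => Finset.sum_congr rfl fun b hb =>
      Finset.sum_congr rfl fun c hc => h3 a ha b hb c hc,
    Finset.sum_congr rfl fun a ha => Finset.sum_congr rfl fun b hb => h2 a ha b hb,
    Finset.sum_congr rfl h1, Finset.sum_const, smul_eq_mul]
  ring

lemma sum_separates (P : Finset (ℝ × ℝ)) (a b : ℝ × ℝ) [∀ c d, Decidable (Separates a b c d)] :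
    ∑ c ∈ P, ∑ d ∈ P, (if Separates a b c d then 1 else 0) =
      2 * (leftCount P a b * leftCount P b a) := by
  have h : ∀ c d, (if Separates a b c d then 1 else 0) =
      (if 0 < orient a b c then 1 else 0) * (if 0 < orient b a d then 1 else 0) +
      (if 0 < orient b a c then 1 else 0) * (if 0 < orient a b d then 1 else 0) := by
    intro c d
    simp only [Separates, orient_swap a b, mul_neg_iff]
    rcases lt_trichotomy (orient a b c) 0 with h1 | h1 | h1 <;>
      rcases lt_trichotomy (orient a b d) 0 with h2 | h2 | h2 <;>
      simp [h1, h2, not_lt.2 h1.le, not_lt.2 h2.le]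
  simp only [h, Finset.sum_add_distrib, ← Finset.sum_mul_sum, ← Finset.card_filter]
  unfold leftCount
  ring

open Classical in
lemma card_convex_distinctQuads_le (P : Finset (ℝ × ℝ)) :
    ((distinctQuads P).filter fun x =>
      ConvexPos ({x.1, x.2.1, x.2.2.1, x.2.2.2} : Set (ℝ × ℝ))).card ≤ 24 * crNum P := by
  set s := (distinctQuads P).filter fun x =>
      ConvexPos ({x.1, x.2.1, x.2.2.1, x.2.2.2} : Set (ℝ × ℝ)) with hs
  set f : (ℝ × ℝ) × (ℝ × ℝ) × (ℝ × ℝ) × (ℝ × ℝ) → Finset (ℝ × ℝ) :=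
    fun x => {x.1, x.2.1, x.2.2.1, x.2.2.2} with hf
  have hcard : ∀ x ∈ s, (f x).card = 4 := by
    rintro ⟨a, b, c, d⟩ hx
    simp only [hs, distinctQuads, Finset.mem_filter] at hx
    obtain ⟨⟨_, h1, h2, h3, h4, h5, h6⟩, _⟩ := hx
    simp only [hf]
    rw [Finset.card_insert_of_notMem (by simp [*]), Finset.card_insert_of_notMem (by simp [*]),
      Finset.card_insert_of_notMem (by simp [*]), Finset.card_singleton]
  refine (Finset.card_le_mul_card_image (f := f) s 24 ?_).trans (Nat.mul_le_mul_left _ ?_)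
  · intro Q hQ
    obtain ⟨y, hy, rfl⟩ := Finset.mem_image.1 hQ
    have h4 := hcard y hy
    have : (distinctQuads (f y)).card = 24 := by rw [card_distinctQuads, h4]
    rw [← this]
    refine Finset.card_le_card fun x hx => ?_
    obtain ⟨hx, hxy⟩ := Finset.mem_filter.1 hx
    simp only [hs, distinctQuads, Finset.mem_filter] at hx ⊢
    refine ⟨?_, hx.1.2⟩
    rw [← hxy]
    simp [hf]
  · unfold crNum
    rw [← Set.ncard_coe_finset]
    refine Set.ncard_le_ncard ?_ ?_
    · intro Q hQ
      obtain ⟨x, hx, rfl⟩ := Finset.mem_image.1 (Finset.mem_coe.1 hQ)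
      refine ⟨?_, hcard x hx, ?_⟩
      · simp only [hs, distinctQuads, Finset.mem_filter, Finset.mem_product] at hx
        simp only [hf, Finset.insert_subset_iff, Finset.singleton_subset_iff]
        exact ⟨hx.1.1.1, hx.1.1.2.1, hx.1.1.2.2.1, hx.1.1.2.2.2⟩
      · have := (Finset.mem_filter.1 hx).2
        simpa [hf] using this
    · exact (P.powerset.finite_toSet).subset fun Q hQ => by simpa using hQ.1

/-- Double counting of pairs of points separated by the line through two further points. -/
lemma distinctQuads_le_crossings {P : Finset (ℝ × ℝ)} (hP : GenPos P) :
    3 * (P.card * (P.card - 1) * (P.card - 2) * (P.card - 3)) ≤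
      12 * ∑ a ∈ P, ∑ b ∈ P, leftCount P a b * leftCount P b a + 24 * crNum P := by
  classical
  set F : ℝ × ℝ → ℝ × ℝ → ℝ × ℝ → ℝ × ℝ → ℕ := fun a b c d =>
    if Separates a b c d then 1 else 0 with hF
  set T := ∑ a ∈ P, ∑ b ∈ P, ∑ c ∈ P, ∑ d ∈ P, F a b c d with hT
  have hTeq : T = 2 * ∑ a ∈ P, ∑ b ∈ P, leftCount P a b * leftCount P b a := by
    simp only [hT, hF, sum_separates, ← Finset.mul_sum]
  have hle : ∀ g : ℝ × ℝ → ℝ × ℝ → ℝ × ℝ → ℝ × ℝ → ℕ,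
      ∑ x ∈ distinctQuads P, g x.1 x.2.1 x.2.2.1 x.2.2.2 ≤
        ∑ a ∈ P, ∑ b ∈ P, ∑ c ∈ P, ∑ d ∈ P, g a b c d := by
    intro g
    refine (Finset.sum_le_sum_of_subset fun x hx => ?_).trans_eq
      (by simp only [Finset.sum_product] : ∑ x ∈ P ×ˢ P ×ˢ P ×ˢ P, g x.1 x.2.1 x.2.2.1 x.2.2.2 = _)
    simp only [distinctQuads, Finset.mem_filter] at hx
    exact hx.1
  have h1 := hle F
  have h2 := hle fun a b c d => F a c b d
  have h3 := hle fun a b c d => F a d b c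
  have h4 := hle fun a b c d => F b c a d
  have h5 := hle fun a b c d => F b d a c
  have h6 := hle fun a b c d => F c d a b
  have e2 : ∑ a ∈ P, ∑ b ∈ P, ∑ c ∈ P, ∑ d ∈ P, F a c b d = T :=
    Finset.sum_congr rfl fun a _ => Finset.sum_comm
  have e3 : ∑ a ∈ P, ∑ b ∈ P, ∑ c ∈ P, ∑ d ∈ P, F a d b c = T :=
    Finset.sum_congr rfl fun a _ =>
      (Finset.sum_congr rfl fun b _ => Finset.sum_comm).trans Finset.sum_comm
  have e4 : ∑ a ∈ P, ∑ b ∈ P, ∑ c ∈ P, ∑ d ∈ P, F b c a d = T :=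
    Finset.sum_comm.trans (Finset.sum_congr rfl fun b _ => Finset.sum_comm)
  have e5 : ∑ a ∈ P, ∑ b ∈ P, ∑ c ∈ P, ∑ d ∈ P, F b d a c = T :=
    Finset.sum_comm.trans (Finset.sum_congr rfl fun b _ =>
      (Finset.sum_congr rfl fun b _ => Finset.sum_comm).trans Finset.sum_comm)
  have e6 : ∑ a ∈ P, ∑ b ∈ P, ∑ c ∈ P, ∑ d ∈ P, F c d a b = T := by
    refine (Finset.sum_congr rfl fun a _ => Finset.sum_comm).trans (Finset.sum_comm.trans ?_)
    exact Finset.sum_congr rfl fun c _ =>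
      (Finset.sum_congr rfl fun a _ => Finset.sum_comm).trans Finset.sum_comm
  rw [e2] at h2
  rw [e3] at h3
  rw [e4] at h4
  rw [e5] at h5
  rw [e6] at h6
  have h7 := card_convex_distinctQuads_le P
  rw [Finset.card_filter] at h7
  have h8 : ∑ x ∈ distinctQuads P, 3 ≤ ∑ x ∈ distinctQuads P,
      (F x.1 x.2.1 x.2.2.1 x.2.2.2 + F x.1 x.2.2.1 x.2.1 x.2.2.2 + F x.1 x.2.2.2 x.2.1 x.2.2.1
      + F x.2.1 x.2.2.1 x.1 x.2.2.2 + F x.2.1 x.2.2.2 x.1 x.2.2.1 + F x.2.2.1 x.2.2.2 x.1 x.2.1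
      + if ConvexPos ({x.1, x.2.1, x.2.2.1, x.2.2.2} : Set (ℝ × ℝ)) then 1 else 0) := by
    refine Finset.sum_le_sum ?_
    rintro ⟨a, b, c, d⟩ hx
    simp only [distinctQuads, Finset.mem_filter, Finset.mem_product] at hx
    obtain ⟨⟨ha, hb, hc, hd⟩, hab, hac, had, hbc, hbd, hcd⟩ := hx
    exact three_le_separating_pairs hab hac had hbc hbd hcd
      (hP.orient_ne_zero hb hc hd hbc hbd hcd) (hP.orient_ne_zero ha hc hd hac had hcd)
      (hP.orient_ne_zero ha hb hd hab had hbd) (hP.orient_ne_zero ha hb hc hab hac hbc)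
  simp only [Finset.sum_add_distrib] at h8
  rw [Finset.sum_const, smul_eq_mul, card_distinctQuads] at h8
  have h1' : ∑ x ∈ distinctQuads P, F x.1 x.2.1 x.2.2.1 x.2.2.2 ≤ T := h1
  omega

lemma crNum_lower_bound {P : Finset (ℝ × ℝ)} (hP : GenPos P) :
    (1 / 8) * ∑ a ∈ P, ∑ b ∈ P.erase a, (2 * (leftCount P a b : ℝ) - (P.card - 2)) ^ 2
      - (P.card : ℝ) ^ 3 / 8 ≤ crNum P := by
  have h := distinctQuads_le_crossings hP
  have h1 : ∑ a ∈ P, ∑ b ∈ P, leftCount P a b * leftCount P b a =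
      ∑ a ∈ P, ∑ b ∈ P.erase a, leftCount P a b * leftCount P b a := by
    refine Finset.sum_congr rfl fun a ha => ?_
    rw [← Finset.add_sum_erase P _ ha]
    simp [leftCount, orient]
  rw [h1] at h
  have h2 : ∀ a ∈ P, ∀ b ∈ P.erase a, (leftCount P a b : ℝ) * leftCount P b a =
      ((P.card : ℝ) - 2) ^ 2 / 4 - (2 * (leftCount P a b : ℝ) - (P.card - 2)) ^ 2 / 4 := by
    intro a ha b hb
    have h3 := leftCount_add_leftCount hP ha (Finset.mem_erase.1 hb).2
      (Finset.mem_erase.1 hb).1.symm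
    have h4 : (leftCount P a b : ℝ) + leftCount P b a + 2 = P.card := by exact_mod_cast h3
    rw [← h4]; ring
  have h5 : ((3 * (P.card * (P.card - 1) * (P.card - 2) * (P.card - 3)) : ℕ) : ℝ) =
      3 * (P.card * (P.card - 1) * (P.card - 2) * (P.card - 3)) := by
    by_cases hn : 3 ≤ P.card
    · push_cast [Nat.cast_sub (show 1 ≤ P.card by omega), Nat.cast_sub (show 2 ≤ P.card by omega),
        Nat.cast_sub hn]
      ring
    · interval_cases P.card <;> norm_num
  have h6 : (3 * (P.card * (P.card - 1) * (P.card - 2) * (P.card - 3)) : ℝ) ≤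
      12 * ∑ a ∈ P, ∑ b ∈ P.erase a, (leftCount P a b : ℝ) * leftCount P b a + 24 * crNum P := by
    rw [← h5]; exact_mod_cast h
  rw [Finset.sum_congr rfl fun a ha => Finset.sum_congr rfl (h2 a ha)] at h6
  simp only [Finset.sum_sub_distrib, ← Finset.sum_div, Finset.sum_const, nsmul_eq_mul] at h6
  have h7 : ∀ a ∈ P, ((P.erase a).card : ℝ) * ((P.card : ℝ) - 2) ^ 2 =
      ((P.card : ℝ) - 1) * ((P.card : ℝ) - 2) ^ 2 := by
    intro a ha
    rw [← Finset.card_erase_add_one ha]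
    push_cast
    ring
  rw [Finset.sum_congr rfl h7, Finset.sum_const, nsmul_eq_mul] at h6
  have h8 : (P.card : ℝ) ≤ (P.card : ℝ) ^ 2 := by exact_mod_cast Nat.le_self_pow two_ne_zero _
  have h9 : (0 : ℝ) ≤ P.card := Nat.cast_nonneg _
  linarith

/-- `X` is the set of the first `X.card` points of `P` in direction `v`, and `v` orders `P`
strictly. -/
structure IsInitial (P X : Finset (ℝ × ℝ)) (v : ℝ × ℝ) : Prop where
  subset : X ⊆ P
  injOn : Set.InjOn (fun p => dot p v) P
  lt : ∀ x ∈ X, ∀ p ∈ P, p ∉ X → dot x v < dot p v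

lemma rank_lt_rank {P : Finset (ℝ × ℝ)} {v x y : ℝ × ℝ} (hx : x ∈ P) (h : dot x v < dot y v) :
    rank P v x < rank P v y := by
  refine Finset.card_lt_card (Finset.ssubset_iff_of_subset ?_ |>.2 ⟨x, ?_, ?_⟩)
  · exact fun p hp => by
      simp only [Finset.mem_filter] at hp ⊢
      exact ⟨hp.1, hp.2.trans h⟩
  · simp [hx, h]
  · simp

namespace IsInitial

variable {P X : Finset (ℝ × ℝ)} {v : ℝ × ℝ}

lemma rank_lt_card (hX : IsInitial P X v) {x : ℝ × ℝ} (hx : x ∈ X) : rank P v x < X.card := by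
  refine Finset.card_lt_card (Finset.ssubset_iff_of_subset ?_ |>.2 ⟨x, hx, by simp⟩)
  intro p hp
  obtain ⟨hp, hpx⟩ := Finset.mem_filter.1 hp
  by_contra h
  exact lt_asymm hpx (hX.lt x hx p hp h)

lemma rank_injOn (hX : IsInitial P X v) : Set.InjOn (rank P v) X := by
  intro x hx y hy h
  by_contra hne
  rcases lt_trichotomy (dot x v) (dot y v) with h' | h' | h'
  · exact (rank_lt_rank (hX.subset hx) h').ne h
  · exact hne (hX.injOn (hX.subset hx) (hX.subset hy) h')
  · exact (rank_lt_rank (hX.subset hy) h').ne' h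

lemma image_rank (hX : IsInitial P X v) : X.image (rank P v) = Finset.range X.card := by
  refine Finset.eq_of_subset_of_card_le ?_ ?_
  · intro i hi
    obtain ⟨x, hx, rfl⟩ := Finset.mem_image.1 hi
    exact Finset.mem_range.2 (hX.rank_lt_card hx)
  · rw [Finset.card_image_of_injOn hX.rank_injOn, Finset.card_range]

lemma sum_rank (hX : IsInitial P X v) {M : Type*} [AddCommMonoid M] (h : ℕ → M) :
    ∑ x ∈ X, h (rank P v x) = ∑ i ∈ Finset.range X.card, h i := by
  rw [← hX.image_rank, Finset.sum_image hX.rank_injOn]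

end IsInitial

/-- Symmetric weights on the edges cancel in pairs up to the difference of vertex weights. -/
lemma sum_mul_antisymm {α : Type*} (X : Finset α) (w : α → ℝ) (s : α → α → ℝ)
    (hs : ∀ x ∈ X, ∀ y ∈ X, s y x = -s x y) :
    2 * ∑ x ∈ X, w x * ∑ y ∈ X, s x y = ∑ x ∈ X, ∑ y ∈ X, (w x - w y) * s x y := by
  have h : ∑ x ∈ X, w x * ∑ y ∈ X, s x y = -∑ x ∈ X, ∑ y ∈ X, w y * s x y := by
    simp only [Finset.mul_sum]
    rw [Finset.sum_comm, ← Finset.sum_neg_distrib]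
    refine Finset.sum_congr rfl fun x hx => ?_
    rw [← Finset.sum_neg_distrib]
    refine Finset.sum_congr rfl fun y hy => ?_
    rw [hs x hx y hy]
    ring
  simp only [sub_mul, Finset.sum_sub_distrib]
  rw [two_mul]
  nth_rewrite 2 [h]
  simp only [Finset.mul_sum]
  ring

section Halfturn

variable {P X : Finset (ℝ × ℝ)} {v : ℝ × ℝ} {G : ℤ → ℝ}

lemma sub_leftCount_comm (hP : GenPos P)
    (hG : ∀ k : ℤ, G (P.card - 1 - k) - G (P.card - 2 - k) = G (k + 1) - G k)
    {x y : ℝ × ℝ} (hx : x ∈ P) (hy : y ∈ P) (hxy : x ≠ y) :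
    G (leftCount P y x + 1) - G (leftCount P y x) =
      G (leftCount P x y + 1) - G (leftCount P x y) := by
  have h := leftCount_add_leftCount hP hx hy hxy
  rw [← hG]
  congr 2 <;> omega

lemma two_mul_sum_weighted_halfturn (hP : GenPos P) (hX : IsInitial P X v)
    (hG : ∀ k : ℤ, G (P.card - 1 - k) - G (P.card - 2 - k) = G (k + 1) - G k) (w : ℝ × ℝ → ℝ) :
    2 * ∑ x ∈ X, w x * ∑ p ∈ P \ X, (G (leftCount P x p + 1) - G (leftCount P x p)) +
      ∑ x ∈ X, ∑ y ∈ X.erase x, (w x - w y) * ((if dot x v < dot y v then (1 : ℝ) else -1) *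
        (G (leftCount P x y + 1) - G (leftCount P x y))) =
      2 * ∑ x ∈ X, w x * (G (P.card - 1 - rank P v x) - G (rank P v x)) := by
  have h1 : ∀ x ∈ X, ∑ p ∈ P \ X, (G (leftCount P x p + 1) - G (leftCount P x p)) +
      ∑ y ∈ X.erase x, (if dot x v < dot y v then (1 : ℝ) else -1) *
        (G (leftCount P x y + 1) - G (leftCount P x y)) =
      G (P.card - 1 - rank P v x) - G (rank P v x) := by
    intro x hx
    rw [← sum_halfturn hP hX.injOn (hX.subset hx) G hG]
    have h2 : P.erase x = (P \ X) ∪ X.erase x := by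
      ext p
      simp only [Finset.mem_erase, Finset.mem_union, Finset.mem_sdiff]
      have hsub : p ∈ X → p ∈ P := fun h => hX.subset h
      by_cases hp : p ∈ X
      · simp [hp, hsub hp]
      · simp only [hp, not_false_eq_true, and_true, and_false, or_false]
        exact ⟨fun h => h.2, fun h => ⟨by rintro rfl; exact hp hx, h⟩⟩
    rw [h2, Finset.sum_union]
    · congr 1
      refine Finset.sum_congr rfl fun p hp => ?_
      rw [if_pos (hX.lt x hx p (Finset.mem_sdiff.1 hp).1 (Finset.mem_sdiff.1 hp).2), one_mul]
    · rw [Finset.disjoint_left]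
      intro p hp hp'
      exact (Finset.mem_sdiff.1 hp).2 (Finset.mem_erase.1 hp').2
  set s : ℝ × ℝ → ℝ × ℝ → ℝ := fun x y => if x = y then 0 else
    (if dot x v < dot y v then (1 : ℝ) else -1) *
        (G (leftCount P x y + 1) - G (leftCount P x y)) with hs
  have hanti : ∀ x ∈ X, ∀ y ∈ X, s y x = -s x y := by
    intro x hx y hy
    by_cases hxy : x = y
    · simp [hs, hxy]
    · have hne : dot x v ≠ dot y v := fun h =>
        hxy (hX.injOn (hX.subset hx) (hX.subset hy) h)
      simp only [hs, hxy, Ne.symm hxy, if_false]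
      rw [sub_leftCount_comm hP hG (hX.subset hx) (hX.subset hy) hxy]
      rcases lt_or_gt_of_ne hne with h | h
      · simp [h, not_lt.2 h.le]
      · simp [h, not_lt.2 h.le]
  have herase : ∀ x ∈ X, ∀ c : ℝ × ℝ → ℝ, ∑ y ∈ X, c y * s x y = ∑ y ∈ X.erase x,
      c y * ((if dot x v < dot y v then (1 : ℝ) else -1) *
        (G (leftCount P x y + 1) - G (leftCount P x y))) := by
    intro x hx c
    rw [← Finset.add_sum_erase X _ hx]
    simp only [hs, if_true, mul_zero, zero_add]
    refine Finset.sum_congr rfl fun y hy => ?_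
    rw [if_neg (Finset.mem_erase.1 hy).1.symm]
  have h3 := sum_mul_antisymm X w s hanti
  rw [Finset.sum_congr rfl fun x hx => herase x hx fun y => w x - w y] at h3
  have herase' : ∀ x ∈ X, ∑ y ∈ X, s x y = ∑ y ∈ X.erase x,
      ((if dot x v < dot y v then (1 : ℝ) else -1) *
        (G (leftCount P x y + 1) - G (leftCount P x y))) := by
    intro x hx
    simpa using herase x hx 1
  rw [← h3, ← mul_add, ← Finset.sum_add_distrib]
  congr 1
  refine Finset.sum_congr rfl fun x hx => ?_
  rw [herase' x hx, ← h1 x hx]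
  ring

lemma sum_bichromatic (hP : GenPos P) (hX : IsInitial P X v)
    (hG : ∀ k : ℤ, G (P.card - 1 - k) - G (P.card - 2 - k) = G (k + 1) - G k) :
    ∑ x ∈ X, ∑ p ∈ P \ X, (G (leftCount P x p + 1) - G (leftCount P x p)) =
      ∑ i ∈ Finset.range X.card, (G (P.card - 1 - i) - G i) := by
  have h := two_mul_sum_weighted_halfturn hP hX hG 1
  rw [← hX.sum_rank fun i : ℕ => G (P.card - 1 - i) - G i]
  simp only [Pi.one_apply, sub_self, zero_mul, Finset.sum_const_zero, add_zero, one_mul] at h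
  linarith

end Halfturn

lemma sum_sq_bichromatic {P X : Finset (ℝ × ℝ)} {v : ℝ × ℝ} (hP : GenPos P)
    (hX : IsInitial P X v) (hcard : P.card = 3 * X.card) :
    ∑ x ∈ X, ∑ p ∈ P \ X, (2 * (leftCount P x p : ℝ) - (P.card - 2)) ^ 2 =
      (10 * (X.card : ℝ) ^ 4 - 4 * (X.card : ℝ) ^ 2) / 3 := by
  set n : ℝ := (P.card : ℝ) with hn
  set G : ℤ → ℝ := fun j => ((2 * j - (n - 1)) ^ 3 - (2 * j - (n - 1))) / 6 with hG
  have h := sum_bichromatic hP hX (G := G) (by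
    intro k; simp only [hG]; push_cast; rw [← hn]; ring)
  have h1 : ∀ k : ℕ, G (k + 1) - G k = (2 * (k : ℝ) - (n - 2)) ^ 2 := by
    intro k; simp only [hG]; push_cast; ring
  simp only [h1] at h
  rw [h]
  have h2 : ∀ M : ℕ, ∑ i ∈ Finset.range M, (G (P.card - 1 - i) - G i) =
      (n ^ 4 / 8 - n ^ 2 / 2 - ((n - 2 * M) ^ 4 / 8 - (n - 2 * M) ^ 2 / 2)) / 3 := by
    intro M
    induction M with
    | zero => simp
    | succ M ih =>
      rw [Finset.sum_range_succ, ih]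
      simp only [hG]
      push_cast
      rw [← hn]
      ring
  rw [h2, hn, hcard]
  push_cast
  ring

/-- The edges inside `X` for which the numbers of points on the two sides differ by less than `q`
number at most what a labelling of the vertices by levels, weakly decreasing along the order
given by `v`, allows. -/
lemma card_balanced_edges_le {P X : Finset (ℝ × ℝ)} {v : ℝ × ℝ} (hP : GenPos P)
    (hX : IsInitial P X v) (q : ℕ) {l : ℕ → ℕ} (hl : Antitone l) :
    ∑ x ∈ X, ∑ y ∈ X.erase x, (if |2 * (leftCount P x y : ℤ) - (P.card - 2)| < q
        then (1 : ℝ) else 0) ≤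
      2 * q * ∑ i ∈ Finset.range X.card, (l i : ℝ) +
        ∑ i ∈ Finset.range X.card,
          ((((Finset.range X.card).filter fun j => l j = l i).card : ℝ) - 1) := by
  set n : ℤ := (P.card : ℤ) with hn
  set H : ℤ → ℤ := fun j => max (-q) (min q (2 * j - (n - 1))) with hH
  set G : ℤ → ℝ := fun j => (H j : ℝ) / 2 with hG
  have hsym : ∀ k : ℤ, G (P.card - 1 - k) - G (P.card - 2 - k) = G (k + 1) - G k := by
    intro k
    have : H (P.card - 1 - k) - H (P.card - 2 - k) = H (k + 1) - H k := by
      simp only [hH]; omega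
    have : (H (P.card - 1 - k) : ℝ) - H (P.card - 2 - k) = H (k + 1) - H k := by exact_mod_cast this
    simp only [hG]
    linarith
  have hf0 : ∀ k : ℤ, 0 ≤ G (k + 1) - G k := by
    intro k
    have : H k ≤ H (k + 1) := by simp only [hH]; omega
    have : (H k : ℝ) ≤ H (k + 1) := by exact_mod_cast this
    simp only [hG]
    linarith
  have hf1 : ∀ k : ℤ, G (k + 1) - G k ≤ 1 := by
    intro k
    have : H (k + 1) ≤ H k + 2 := by simp only [hH]; omega
    have : (H (k + 1) : ℝ) ≤ H k + 2 := by exact_mod_cast this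
    simp only [hG]
    linarith
  have hfq : ∀ k : ℤ, |2 * k - (n - 2)| < q → 1 ≤ G (k + 1) - G k := by
    intro k hk
    rw [abs_lt] at hk
    have : H k + 2 ≤ H (k + 1) := by simp only [hH]; omega
    have : (H k : ℝ) + 2 ≤ H (k + 1) := by exact_mod_cast this
    simp only [hG]
    linarith
  have hGq : ∀ i j : ℤ, G i - G j ≤ q := by
    intro i j
    have : H i - H j ≤ 2 * q := by simp only [hH]; omega
    have : (H i : ℝ) - H j ≤ 2 * q := by exact_mod_cast this
    simp only [hG]
    linarith
  set w : ℝ × ℝ → ℝ := fun x => l (rank P v x) with hw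
  have key := two_mul_sum_weighted_halfturn hP hX hsym w
  have h1 : 0 ≤ ∑ x ∈ X, w x * ∑ p ∈ P \ X, (G (leftCount P x p + 1) - G (leftCount P x p)) :=
    Finset.sum_nonneg fun x _ => mul_nonneg (Nat.cast_nonneg _) (Finset.sum_nonneg fun p _ => hf0 _)
  have h2 : ∑ x ∈ X, w x * (G (P.card - 1 - rank P v x) - G (rank P v x)) ≤
      q * ∑ i ∈ Finset.range X.card, (l i : ℝ) := by
    rw [← hX.sum_rank fun i => (l i : ℝ), Finset.mul_sum]
    refine Finset.sum_le_sum fun x _ => ?_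
    rw [mul_comm]
    exact mul_le_mul_of_nonneg_right (hGq _ _) (Nat.cast_nonneg _)
  have h3 : ∀ x ∈ X, ∀ y ∈ X.erase x,
      (if |2 * (leftCount P x y : ℤ) - (n - 2)| < q then (1 : ℝ) else 0) ≤
      (w x - w y) * ((if dot x v < dot y v then (1 : ℝ) else -1) *
        (G (leftCount P x y + 1) - G (leftCount P x y))) +
        (if l (rank P v y) = l (rank P v x) then (1 : ℝ) else 0) := by
    intro x hx y hy
    obtain ⟨hyx, hy⟩ := Finset.mem_erase.1 hy
    have hle : (if |2 * (leftCount P x y : ℤ) - (n - 2)| < q then (1 : ℝ) else 0) ≤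
        G (leftCount P x y + 1) - G (leftCount P x y) := by
      split_ifs with h
      · exact hfq _ h
      · exact hf0 _
    by_cases hlev : l (rank P v y) = l (rank P v x)
    · simp only [hw, hlev, sub_self, zero_mul, zero_add, if_true]
      split_ifs <;> norm_num
    · rw [if_neg hlev, add_zero, ← mul_assoc]
      refine hle.trans (le_mul_of_one_le_left (hf0 _) ?_)
      have hne : dot x v ≠ dot y v := fun h =>
        hyx (hX.injOn (hX.subset hx) (hX.subset hy) h).symm
      rcases lt_or_gt_of_ne hne with h | h
      · have h4 := hl (rank_lt_rank (hX.subset hx) h).le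
        have h5 : l (rank P v y) + 1 ≤ l (rank P v x) := by omega
        have h6 : (l (rank P v y) : ℝ) + 1 ≤ l (rank P v x) := by exact_mod_cast h5
        simp only [h, if_true, hw]
        linarith
      · have h4 := hl (rank_lt_rank (hX.subset hy) h).le
        have h5 : l (rank P v x) + 1 ≤ l (rank P v y) := by omega
        have h6 : (l (rank P v x) : ℝ) + 1 ≤ l (rank P v y) := by exact_mod_cast h5
        simp only [not_lt.2 h.le, if_false, hw]
        linarith
  have h4 : ∑ x ∈ X, ∑ y ∈ X.erase x, (if l (rank P v y) = l (rank P v x) then (1 : ℝ) else 0) =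
      ∑ i ∈ Finset.range X.card,
          ((((Finset.range X.card).filter fun j => l j = l i).card : ℝ) - 1) := by
    rw [← hX.sum_rank fun i =>
      ((((Finset.range X.card).filter fun j => l j = l i).card : ℝ) - 1)]
    refine Finset.sum_congr rfl fun x hx => ?_
    have h5 := Finset.add_sum_erase X
      (fun y => if l (rank P v y) = l (rank P v x) then (1 : ℝ) else 0) hx
    have h6 := hX.sum_rank fun j => if l j = l (rank P v x) then (1 : ℝ) else 0
    rw [Finset.card_filter]
    push_cast
    rw [← h6, ← h5]
    simp
  have h5 := Finset.sum_le_sum fun x hx => Finset.sum_le_sum (h3 x hx)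
  simp only [Finset.sum_add_distrib] at h5
  rw [h4] at h5
  linarith

lemma sum_range_quadratic (c₀ c₁ c₂ : ℝ) (M : ℕ) :
    ∑ j ∈ Finset.range M, (c₀ + c₁ * j + c₂ * (j : ℝ) ^ 2) =
      c₀ * M + c₁ * (M * (M - 1) / 2) + c₂ * ((M - 1) * M * (2 * M - 1) / 6) := by
  induction M with
  | zero => simp
  | succ M ih => rw [Finset.sum_range_succ, ih]; push_cast; ring

lemma card_le_of_forall_mem_Ioc {s : Finset ℕ} {α β : ℝ} (hβ : 0 ≤ β) (h : β ≤ α)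
    (hs : ∀ i ∈ s, β < (i : ℝ) + 1 ∧ (i : ℝ) + 1 ≤ α) : (s.card : ℝ) ≤ α - β + 1 := by
  have hsub : s ⊆ Finset.Ico ⌊β⌋₊ ⌊α⌋₊ := by
    intro i hi
    obtain ⟨h1, h2⟩ := hs i hi
    have h3 : ⌊β⌋₊ < i + 1 := (Nat.floor_lt hβ).2 (by exact_mod_cast h1)
    have h4 : i + 1 ≤ ⌊α⌋₊ := Nat.le_floor (by exact_mod_cast h2)
    exact Finset.mem_Ico.2 ⟨by omega, by omega⟩
  have h1 := Finset.card_le_card hsub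
  rw [Nat.card_Ico] at h1
  have h2 : ⌊β⌋₊ ≤ ⌊α⌋₊ := Nat.floor_le_floor h
  have h3 : s.card + ⌊β⌋₊ ≤ ⌊α⌋₊ := by omega
  have h4 : (s.card : ℝ) + ⌊β⌋₊ ≤ ⌊α⌋₊ := by exact_mod_cast h3
  have h5 := Nat.floor_le (hβ.trans h)
  have h6 := Nat.lt_floor_add_one β
  linarith

lemma card_le_of_forall_add_one_le {s : Finset ℕ} {α : ℝ} (hα : 0 ≤ α)
    (hs : ∀ i ∈ s, (i : ℝ) + 1 ≤ α) : (s.card : ℝ) ≤ α := by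
  have hsub : s ⊆ Finset.range ⌊α⌋₊ := by
    intro i hi
    have h4 : i + 1 ≤ ⌊α⌋₊ := Nat.le_floor (by exact_mod_cast hs i hi)
    exact Finset.mem_range.2 (by omega)
  have h1 := Finset.card_le_card hsub
  rw [Finset.card_range] at h1
  exact (Nat.cast_le.2 h1).trans (Nat.floor_le hα)

/-- The level labelling with `R` levels whose sizes form an arithmetic progression of
difference `q`. -/
lemma exists_level_labelling {m : ℕ} (q : ℕ) {R : ℕ} (hR : 1 ≤ R)
    (h : (q : ℝ) * (R * (R - 1)) ≤ 2 * m) :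
    ∃ l : ℕ → ℕ, Antitone l ∧
      2 * q * ∑ i ∈ Finset.range m, (l i : ℝ) +
        ∑ i ∈ Finset.range m, ((((Finset.range m).filter fun j => l j = l i).card : ℝ) - 1) ≤
      (m : ℝ) ^ 2 / R + q * m * (R - 1) - q ^ 2 * ((R - 1) * R * (R + 1)) / 12 + m := by
  have hR0 : (0 : ℝ) < R := by exact_mod_cast hR
  have hq0 : (0 : ℝ) ≤ q := Nat.cast_nonneg _
  set b : ℕ → ℝ := fun j => (R - j) * (m / R - q * j / 2) with hb
  set σ : ℕ → ℝ := fun j => m / R + q * (R - 1) / 2 - q * j with hσ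
  have hbσ : ∀ j, b j = b (j + 1) + σ j := by intro j; simp only [hb, hσ]; push_cast; ring
  have hmR : (q : ℝ) * (R - 1) / 2 ≤ m / R := by
    rw [div_le_div_iff₀ (by norm_num) hR0]; linarith
  have hσ0 : ∀ j, j < R → 0 ≤ σ j := by
    intro j hj
    have h1 : (j : ℝ) + 1 ≤ R := by exact_mod_cast hj
    have h2 : (q : ℝ) * j ≤ q * (R - 1) := mul_le_mul_of_nonneg_left (by linarith) hq0
    simp only [hσ]; linarith
  have hbR : b R = 0 := by simp [hb]
  have hb0 : b 0 = m := by simp only [hb]; push_cast; field_simp; ring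
  have hbnn : ∀ j, j ≤ R → 0 ≤ b j := by
    intro j hj
    rcases hj.eq_or_lt with rfl | hj
    · exact hbR.ge
    have h1 : (j : ℝ) + 1 ≤ R := by exact_mod_cast hj
    have h2 : (q : ℝ) * j ≤ q * (R - 1) := mul_le_mul_of_nonneg_left (by linarith) hq0
    exact mul_nonneg (by linarith) (by linarith)
  have hbanti : ∀ j k, j ≤ k → k ≤ R → b k ≤ b j := by
    intro j k hjk
    induction k, hjk using Nat.le_induction with
    | base => intro _; exact le_rfl
    | succ k hk ih =>
      intro hkR
      have := hbσ k
      have := hσ0 k (by omega)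
      have := ih (by omega)
      linarith
  classical
  set l : ℕ → ℕ := fun i => Nat.findGreatest (fun j => (i : ℝ) + 1 ≤ b j) (R - 1) with hl
  have hlle : ∀ i, l i ≤ R - 1 := fun i => Nat.findGreatest_le _
  have hlb : ∀ i < m, (i : ℝ) + 1 ≤ b (l i) := by
    intro i hi
    exact Nat.findGreatest_spec (P := fun j => (i : ℝ) + 1 ≤ b j) (Nat.zero_le _)
      (by rw [hb0]; exact_mod_cast hi)
  have hlb' : ∀ i, b (l i + 1) < (i : ℝ) + 1 := by
    intro i
    rcases (hlle i).eq_or_lt with h1 | h1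
    · rw [h1, Nat.sub_add_cancel hR, hbR]; positivity
    · exact not_le.1 (Nat.findGreatest_is_greatest (P := fun j => (i : ℝ) + 1 ≤ b j)
        (Nat.lt_succ_self _) h1)
  refine ⟨l, ?_, ?_⟩
  · intro i j hij
    refine Nat.findGreatest_mono_left (fun k hk => ?_) _
    have : (i : ℝ) ≤ j := by exact_mod_cast hij
    exact (by linarith : (i : ℝ) + 1 ≤ j + 1).trans hk
  have hsum : ∑ i ∈ Finset.range m, (l i : ℝ) ≤ ∑ j ∈ Finset.range R, b (j + 1) := by
    have h1 : ∀ i ∈ Finset.range m, (l i : ℝ) =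
        ∑ j ∈ Finset.range R, if j < l i then (1 : ℝ) else 0 := by
      intro i _
      have h2 : (Finset.range R).filter (fun j => j < l i) = Finset.range (l i) := by
        ext j
        have := hlle i
        simp only [Finset.mem_filter, Finset.mem_range]
        omega
      rw [Finset.sum_boole, h2, Finset.card_range]
    rw [Finset.sum_congr rfl h1, Finset.sum_comm]
    refine Finset.sum_le_sum fun j hj => ?_
    have hj := Finset.mem_range.1 hj
    rw [Finset.sum_boole]
    refine card_le_of_forall_add_one_le (hbnn _ hj) fun i hi => ?_
    obtain ⟨hi, hji⟩ := Finset.mem_filter.1 hi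
    refine (hlb i (Finset.mem_range.1 hi)).trans (hbanti _ _ hji ?_)
    have := hlle i
    omega
  have hcard : ∀ L < R, (((Finset.range m).filter fun j => l j = L).card : ℝ) ≤ σ L + 1 := by
    intro L hL
    have h1 := card_le_of_forall_mem_Ioc (s := (Finset.range m).filter fun j => l j = L)
      (hbnn (L + 1) hL) (hbanti L (L + 1) (by omega) hL) (by
        intro i hi
        obtain ⟨him, rfl⟩ := Finset.mem_filter.1 hi
        exact ⟨hlb' i, hlb i (Finset.mem_range.1 him)⟩)
    have := hbσ L
    linarith
  have hsame : ∑ i ∈ Finset.range m,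
      ((((Finset.range m).filter fun j => l j = l i).card : ℝ) - 1) ≤
      ∑ L ∈ Finset.range R, (σ L + 1) * σ L := by
    have hlR : ∀ i, l i < R := fun i => by have := hlle i; omega
    calc _ ≤ ∑ i ∈ Finset.range m, σ (l i) :=
          Finset.sum_le_sum fun i _ => by linarith [hcard _ (hlR i)]
      _ = ∑ L ∈ Finset.range R, ∑ i ∈ (Finset.range m).filter fun j => l j = L, σ (l i) :=
          (Finset.sum_fiberwise_of_maps_to (fun i _ => Finset.mem_range.2 (hlR i)) _).symm
      _ ≤ _ := Finset.sum_le_sum fun L hL => by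
          have hL := Finset.mem_range.1 hL
          rw [Finset.sum_congr rfl fun i hi => by rw [(Finset.mem_filter.1 hi).2],
            Finset.sum_const, nsmul_eq_mul]
          exact mul_le_mul_of_nonneg_right (hcard L hL) (hσ0 L hL)
  have hb_sum := sum_range_quadratic ((R - 1) * (m / R - q / 2)) (-(m / R - q / 2) - (R - 1) * q / 2)
    (q / 2) R
  have hσ_sum := sum_range_quadratic
    ((m / R + q * (R - 1) / 2 + 1) * (m / R + q * (R - 1) / 2))
    (-q * (2 * (m / R + q * (R - 1) / 2) + 1)) (q ^ 2) R
  have e1 : ∑ j ∈ Finset.range R, b (j + 1) = _ :=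
    (Finset.sum_congr rfl fun j _ => by simp only [hb]; push_cast; ring).trans hb_sum
  have e2 : ∑ j ∈ Finset.range R, (σ j + 1) * σ j = _ :=
    (Finset.sum_congr rfl fun j _ => by simp only [hσ]; ring).trans hσ_sum
  have e3 := mul_le_mul_of_nonneg_left hsum (by positivity : (0 : ℝ) ≤ 2 * q)
  rw [e1] at e3
  rw [e2] at hsame
  refine (add_le_add e3 hsame).trans (le_of_eq ?_)
  field_simp
  ring

/-- Telescoping the bounds given by level labellings over the number of levels. -/
lemma sum_truncated_sq_le {m q : ℕ} {O : ℝ}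
    (hO : ∀ R : ℕ, 1 ≤ R → (q : ℝ) * (R * (R - 1)) ≤ 2 * m →
      O ≤ (m : ℝ) ^ 2 / R + q * m * (R - 1) - q ^ 2 * ((R - 1) * R * (R + 1)) / 12 + m) (N : ℕ) :
    ∑ r ∈ Finset.range N, (if (q : ℝ) * ((r + 1) * (r + 2)) ≤ 2 * m then
      ((r : ℝ) + 1) * (r + 2) * (m / ((r + 1) * (r + 2)) - q / 2) ^ 2 else 0) ≤
      (m : ℝ) * (m - 1) - O + 2 * m := by
  induction N with
  | zero =>
    have := hO 1 le_rfl (by push_cast; ring_nf; positivity)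
    push_cast at this
    rw [Finset.sum_range_zero]
    linarith
  | succ N ih =>
    by_cases hN : (q : ℝ) * ((N + 1) * (N + 2)) ≤ 2 * m
    · have h1 := hO (N + 2) (by omega) (by push_cast; linarith)
      have h2 : ∀ M : ℕ, ∑ r ∈ Finset.range M,
          ((r : ℝ) + 1) * (r + 2) * (m / ((r + 1) * (r + 2)) - q / 2) ^ 2 =
          (m : ℝ) ^ 2 - ((m : ℝ) ^ 2 / (M + 1) + q * m * M - q ^ 2 * (M * (M + 1) * (M + 2)) / 12) := by
        intro M
        induction M with
        | zero => simp
        | succ M ih =>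
          rw [Finset.sum_range_succ, ih]
          push_cast
          field_simp
          ring
      have h3 : ∑ r ∈ Finset.range (N + 1), (if (q : ℝ) * ((r + 1) * (r + 2)) ≤ 2 * m then
          ((r : ℝ) + 1) * (r + 2) * (m / ((r + 1) * (r + 2)) - q / 2) ^ 2 else 0) ≤
          ∑ r ∈ Finset.range (N + 1),
            ((r : ℝ) + 1) * (r + 2) * (m / ((r + 1) * (r + 2)) - q / 2) ^ 2 := by
        refine Finset.sum_le_sum fun r _ => ?_
        split_ifs
        · exact le_rfl
        · positivity
      rw [h2] at h3
      push_cast at h1 h3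
      have e1 : (N : ℝ) + 1 + 1 = N + 2 := by ring
      have e2 : (N : ℝ) + 2 - 1 = N + 1 := by ring
      rw [e1] at h3
      rw [e2] at h1
      linarith
    · rw [Finset.sum_range_succ, if_neg hN, add_zero]
      exact ih

lemma sq_eq_sum_range_odd {d : ℤ} (h0 : 0 ≤ d) {n : ℕ} (hd : d ≤ n) :
    (d : ℝ) ^ 2 = ∑ q ∈ Finset.range n,
      (2 * (q : ℝ) + 1) * (1 - if d < ((q + 1 : ℕ) : ℤ) then 1 else 0) := by
  lift d to ℕ using h0
  have hd : d ≤ n := by exact_mod_cast hd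
  induction n, hd using Nat.le_induction with
  | base =>
    have h : ∀ q ∈ Finset.range d,
        (2 * (q : ℝ) + 1) * (1 - if (d : ℤ) < ((q + 1 : ℕ) : ℤ) then 1 else 0) = 2 * q + 1 := by
      intro q hq
      have := Finset.mem_range.1 hq
      rw [if_neg (by omega)]
      ring
    rw [Finset.sum_congr rfl h]
    clear h
    induction d with
    | zero => simp
    | succ d ih => rw [Finset.sum_range_succ, ← ih (by simp)]; push_cast; ring
  | succ n hn ih =>
    rw [Finset.sum_range_succ, ← ih (by exact_mod_cast hn), if_pos (by omega)]
    ring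

lemma sum_range_truncated_sq_ge {m n w : ℕ} (hw : 2 ≤ w) (hmn : m ≤ n) :
    2 / 3 * (m : ℝ) ^ 4 / w ^ 3 - 2 * m ^ 3 / w ^ 2 ≤
      ∑ q ∈ Finset.range n, (2 * (q : ℝ) + 1) *
        (if ((q + 1 : ℕ) : ℝ) * w ≤ 2 * m then
          (w : ℝ) * (m / w - ((q + 1 : ℕ) : ℝ) / 2) ^ 2 else 0) := by
  have hw2 : (2 : ℝ) ≤ w := by exact_mod_cast hw
  have hw0 : (0 : ℝ) < w := by linarith
  set T : ℝ := 2 * m / w with hT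
  have hT0 : 0 ≤ T := by positivity
  have hTm : T ≤ m := by
    rw [hT, div_le_iff₀ hw0]
    nlinarith [(Nat.cast_nonneg m : (0 : ℝ) ≤ m)]
  set K : ℕ := ⌊T⌋₊ with hK
  have hKT : (K : ℝ) ≤ T := Nat.floor_le hT0
  have hTK : T < K + 1 := Nat.lt_floor_add_one T
  have hKn : K ≤ n := by
    have : (K : ℝ) ≤ n := hKT.trans (hTm.trans (by exact_mod_cast hmn))
    exact_mod_cast this
  have h1 : ∑ q ∈ Finset.range K, (2 * (q : ℝ) + 1) * (w * (m / w - ((q : ℝ) + 1) / 2) ^ 2) ≤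
      ∑ q ∈ Finset.range n, (2 * (q : ℝ) + 1) *
        (if ((q + 1 : ℕ) : ℝ) * w ≤ 2 * m then
          (w : ℝ) * (m / w - ((q + 1 : ℕ) : ℝ) / 2) ^ 2 else 0) := by
    refine (le_of_eq (Finset.sum_congr rfl fun q hq => ?_)).trans
      (Finset.sum_le_sum_of_subset_of_nonneg (Finset.range_mono hKn) fun q _ _ => ?_)
    · have hq : q + 1 ≤ K := Finset.mem_range.1 hq
      have h2 : ((q + 1 : ℕ) : ℝ) ≤ 2 * m / w := (Nat.cast_le.2 hq).trans hKT
      rw [if_pos ((le_div_iff₀ hw0).1 h2)]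
      push_cast
      rfl
    · split_ifs <;> positivity
  refine le_trans ?_ h1
  have h2 : ∀ M : ℕ, ∑ q ∈ Finset.range M, (2 * (q : ℝ) + 1) * (T - (q + 1)) ^ 2 =
      T ^ 2 * M ^ 2 - T * (M * (M + 1) * (4 * M - 1)) / 3 + M ^ 2 * (M + 1) ^ 2 / 2
        - M * (M + 1) * (2 * M + 1) / 6 := by
    intro M
    induction M with
    | zero => simp
    | succ M ih => rw [Finset.sum_range_succ, ih]; push_cast; ring
  have h3 : ∑ q ∈ Finset.range K, (2 * (q : ℝ) + 1) * (w * (m / w - ((q : ℝ) + 1) / 2) ^ 2) =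
      (w : ℝ) / 4 * ∑ q ∈ Finset.range K, (2 * (q : ℝ) + 1) * (T - ((q : ℝ) + 1)) ^ 2 := by
    rw [Finset.mul_sum]
    refine Finset.sum_congr rfl fun q _ => ?_
    rw [hT]
    ring
  have h4 : T ^ 4 / 6 - T ^ 3 ≤ T ^ 2 * K ^ 2 - T * (K * (K + 1) * (4 * K - 1)) / 3 +
      K ^ 2 * (K + 1) ^ 2 / 2 - K * (K + 1) * (2 * K + 1) / 6 := by
    obtain ⟨f, hf⟩ : ∃ f, T = K + f := ⟨T - K, by ring⟩
    have hf0 : 0 ≤ f := by linarith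
    have hf1 : f ≤ 1 := by linarith
    have hk : (0 : ℝ) ≤ K := Nat.cast_nonneg _
    have hf3 : 0 ≤ f ^ 3 * (1 - f) := mul_nonneg (by positivity) (by linarith)
    have hf2 : 0 ≤ K * f ^ 2 * (1 - f) := mul_nonneg (by positivity) (by linarith)
    have hk2 : (K : ℝ) ≤ K ^ 2 := by exact_mod_cast Nat.le_self_pow (by norm_num) K
    have p1 : 0 ≤ (K : ℝ) ^ 3 := by positivity
    have p2 : 0 ≤ (K : ℝ) ^ 2 * f := by positivity
    have p3 : 0 ≤ (K : ℝ) * f ^ 2 := by positivity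
    have p4 : 0 ≤ f ^ 3 := by positivity
    have p5 : 0 ≤ (K : ℝ) ^ 2 := by positivity
    have p6 : 0 ≤ (K : ℝ) * f := by positivity
    rw [hf]
    nlinarith
  rw [h3, h2]
  refine le_trans (le_of_eq ?_) (mul_le_mul_of_nonneg_left h4 (by positivity : (0 : ℝ) ≤ w / 4))
  rw [hT]
  field_simp
  ring

/-- Lower bound for the contribution of the edges inside an initial third. -/
lemma sum_sq_monochromatic_ge {P X : Finset (ℝ × ℝ)} {v : ℝ × ℝ} (hP : GenPos P)
    (hX : IsInitial P X v) (hcard : P.card = 3 * X.card) (N : ℕ) :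
    2 / 3 * (X.card : ℝ) ^ 4 * ∑ r ∈ Finset.range N, 1 / (((r : ℝ) + 1) * (r + 2)) ^ 3 -
      22 * (X.card : ℝ) ^ 3 ≤
      ∑ x ∈ X, ∑ y ∈ X.erase x, (2 * (leftCount P x y : ℝ) - (P.card - 2)) ^ 2 := by
  set m := X.card with hm
  set n := P.card with hn
  set O : ℕ → ℝ := fun q => ∑ x ∈ X, ∑ y ∈ X.erase x,
    (if |2 * (leftCount P x y : ℤ) - (n - 2)| < q then (1 : ℝ) else 0) with hO
  have h1 : ∑ x ∈ X, ∑ y ∈ X.erase x, (2 * (leftCount P x y : ℝ) - (n - 2)) ^ 2 =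
      ∑ q ∈ Finset.range n, (2 * (q : ℝ) + 1) * (m * (m - 1) - O (q + 1)) := by
    have h2 : ∀ x ∈ X, ∀ y ∈ X.erase x, (2 * (leftCount P x y : ℝ) - (n - 2)) ^ 2 =
        ∑ q ∈ Finset.range n, (2 * (q : ℝ) + 1) *
          (1 - if |2 * (leftCount P x y : ℤ) - (n - 2)| < ((q + 1 : ℕ) : ℤ) then 1 else 0) := by
      intro x hx y hy
      obtain ⟨hyx, hy⟩ := Finset.mem_erase.1 hy
      have h3 := leftCount_add_leftCount hP (hX.subset hx) (hX.subset hy) hyx.symm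
      rw [← sq_eq_sum_range_odd (abs_nonneg _) (abs_le.2 ⟨by omega, by omega⟩)]
      push_cast
      rw [sq_abs]
    rw [Finset.sum_congr rfl fun x hx => Finset.sum_congr rfl (h2 x hx)]
    rw [Finset.sum_congr rfl fun x hx => Finset.sum_comm, Finset.sum_comm]
    refine Finset.sum_congr rfl fun q _ => ?_
    have h3 : ∑ x ∈ X, ∑ _y ∈ X.erase x, (1 : ℝ) = m * (m - 1) := by
      rw [Finset.sum_congr rfl fun x hx => by
        rw [Finset.sum_const, Finset.card_erase_of_mem hx, nsmul_eq_mul, mul_one,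
          Nat.cast_pred (Finset.card_pos.2 ⟨x, hx⟩)], Finset.sum_const, nsmul_eq_mul]
    simp only [← Finset.mul_sum, Finset.sum_sub_distrib, hO, h3]
  rw [h1]
  have h2 : ∀ q, ∑ r ∈ Finset.range N,
      (if ((q + 1 : ℕ) : ℝ) * ((r + 1) * (r + 2)) ≤ 2 * m then
      ((r : ℝ) + 1) * (r + 2) * (m / ((r + 1) * (r + 2)) - ((q + 1 : ℕ) : ℝ) / 2) ^ 2 else 0) ≤
      (m : ℝ) * (m - 1) - O (q + 1) + 2 * m := by
    intro q
    refine sum_truncated_sq_le (fun R hR h => ?_) N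
    obtain ⟨l, hl, hle⟩ := exists_level_labelling (q + 1) hR h
    exact (card_balanced_edges_le hP hX (q + 1) hl).trans hle
  have h3 : ∑ q ∈ Finset.range n, (2 * (q : ℝ) + 1) * (∑ r ∈ Finset.range N,
      (if ((q + 1 : ℕ) : ℝ) * ((r + 1) * (r + 2)) ≤ 2 * m then
      ((r : ℝ) + 1) * (r + 2) * (m / ((r + 1) * (r + 2)) - ((q + 1 : ℕ) : ℝ) / 2) ^ 2 else 0) -
        2 * m) ≤
      ∑ q ∈ Finset.range n, (2 * (q : ℝ) + 1) * (m * (m - 1) - O (q + 1)) :=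
    Finset.sum_le_sum fun q _ => mul_le_mul_of_nonneg_left (by linarith [h2 q]) (by positivity)
  refine le_trans ?_ h3
  have h4 : ∑ q ∈ Finset.range n, (2 * (q : ℝ) + 1) = (n : ℝ) ^ 2 := by
    have h := sum_range_quadratic 1 2 0 n
    simp only [zero_mul, add_zero] at h
    simp only [add_comm (2 * _) (1 : ℝ), h]
    ring
  simp only [mul_sub, Finset.sum_sub_distrib, Finset.mul_sum]
  rw [← Finset.sum_mul, h4, Finset.sum_comm]
  have h5 : ∀ r ∈ Finset.range N,
      2 / 3 * (m : ℝ) ^ 4 * (1 / (((r : ℝ) + 1) * (r + 2)) ^ 3) -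
        2 * (m : ℝ) ^ 3 * (1 / ((r + 1) * (r + 2))) ≤
      ∑ q ∈ Finset.range n, (2 * (q : ℝ) + 1) *
        (if ((q + 1 : ℕ) : ℝ) * ((r + 1) * (r + 2)) ≤ 2 * m then
          ((r : ℝ) + 1) * (r + 2) * (m / ((r + 1) * (r + 2)) - ((q + 1 : ℕ) : ℝ) / 2) ^ 2
          else 0) := by
    intro r _
    have h6 := sum_range_truncated_sq_ge (m := m) (n := n) (w := (r + 1) * (r + 2))
      (by nlinarith) (by omega)
    push_cast at h6 ⊢
    refine le_trans ?_ h6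
    have h7 : (1 : ℝ) ≤ (r + 1) * (r + 2) := by
      have : (0 : ℝ) ≤ r := Nat.cast_nonneg _
      nlinarith
    have h8 : 2 * (m : ℝ) ^ 3 / ((r + 1) * (r + 2)) ^ 2 ≤
        2 * (m : ℝ) ^ 3 * (1 / ((r + 1) * (r + 2))) := by
      rw [mul_one_div]
      refine div_le_div_of_nonneg_left (by positivity) (by positivity) ?_
      nlinarith
    rw [mul_one_div]
    linarith
  have h6 := Finset.sum_le_sum h5
  rw [Finset.sum_sub_distrib, ← Finset.mul_sum, ← Finset.mul_sum] at h6
  have h7 : ∑ r ∈ Finset.range N, 1 / (((r : ℝ) + 1) * (r + 2)) ≤ 1 := by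
    have : ∀ M : ℕ, ∑ r ∈ Finset.range M, 1 / (((r : ℝ) + 1) * (r + 2)) = 1 - 1 / (M + 1) := by
      intro M
      induction M with
      | zero => simp
      | succ M ih => rw [Finset.sum_range_succ, ih]; push_cast; field_simp; ring
    rw [this]
    have : (0 : ℝ) ≤ 1 / ((N : ℝ) + 1) := by positivity
    linarith
  have h8 := mul_le_mul_of_nonneg_left h7 (by positivity : (0 : ℝ) ≤ 2 * (m : ℝ) ^ 3)
  have h9 : (n : ℝ) = 3 * m := by exact_mod_cast hcard
  simp only [Finset.mul_sum] at h6 ⊢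
  rw [h9]
  simp only [← Finset.mul_sum] at h6 ⊢
  nlinarith [(by positivity : (0 : ℝ) ≤ (m : ℝ) ^ 3)]

lemma hasSum_one_div_mul_add_one_cube :
    HasSum (fun r : ℕ => 1 / (((r : ℝ) + 1) * (r + 2)) ^ 3) (10 - Real.pi ^ 2) := by
  have hz : HasSum (fun r : ℕ => 1 / ((r : ℝ) + 1) ^ 2) (Real.pi ^ 2 / 6) := by
    have := (hasSum_nat_add_iff' 1).2 hasSum_zeta_two
    simpa using this
  have hz' : HasSum (fun r : ℕ => 1 / ((r : ℝ) + 2) ^ 2) (Real.pi ^ 2 / 6 - 1) := by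
    have := (hasSum_nat_add_iff' 1).2 hz
    simp only [Finset.range_one, Finset.sum_singleton] at this
    norm_num [add_assoc] at this ⊢
    exact this
  have htel : ∀ k : ℕ, 1 ≤ k →
      HasSum (fun r : ℕ => 1 / ((r : ℝ) + 1) ^ k - 1 / ((r : ℝ) + 2) ^ k) 1 := by
    intro k hk
    have hnonneg : ∀ r : ℕ, 0 ≤ 1 / ((r : ℝ) + 1) ^ k - 1 / ((r : ℝ) + 2) ^ k := by
      intro r
      rw [sub_nonneg]
      refine one_div_le_one_div_of_le (by positivity) (by gcongr; norm_num)
    rw [hasSum_iff_tendsto_nat_of_nonneg hnonneg]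
    have h : ∀ M : ℕ, ∑ r ∈ Finset.range M, (1 / ((r : ℝ) + 1) ^ k - 1 / ((r : ℝ) + 2) ^ k) =
        1 - (1 / ((M : ℝ) + 1)) ^ k := by
      intro M
      induction M with
      | zero => simp
      | succ M ih =>
        rw [Finset.sum_range_succ, ih, one_div_pow, one_div_pow]
        push_cast
        rw [add_assoc (M : ℝ) 1 1]
        norm_num
    simp only [h]
    have := (tendsto_one_div_add_atTop_nhds_zero_nat (𝕜 := ℝ)).pow k
    simpa [zero_pow (by omega : k ≠ 0)] using this.const_sub 1
  have h := ((htel 3 (by norm_num)).sub ((hz.add hz').mul_left 3)).add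
    ((htel 1 le_rfl).mul_left 6)
  have hval : 1 - 3 * (Real.pi ^ 2 / 6 + (Real.pi ^ 2 / 6 - 1)) + 6 * 1 = 10 - Real.pi ^ 2 := by
    ring
  rw [hval] at h
  refine h.congr_fun fun r => ?_
  field_simp
  ring

/-- Strict separation of `X` from the rest of `P` can be achieved by a direction that also orders
`P` strictly. -/
lemma exists_isInitial {P X : Finset (ℝ × ℝ)} (hX : X ⊆ P) {v : ℝ × ℝ}
    (hv : ∀ x ∈ X, ∀ p ∈ P, p ∉ X → dot x v < dot p v) : ∃ v', IsInitial P X v' := by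
  classical
  have hadd : ∀ (p : ℝ × ℝ) (ε s : ℝ), dot p (v + ε • (1, s)) = dot p v + ε * (p.1 + p.2 * s) := by
    intro p ε s
    simp [dot]
    ring
  have hfin : {s : ℝ | ∃ p ∈ P, ∃ q ∈ P, p ≠ q ∧ p.1 + p.2 * s = q.1 + q.2 * s}.Finite := by
    have : {s : ℝ | ∃ p ∈ P, ∃ q ∈ P, p ≠ q ∧ p.1 + p.2 * s = q.1 + q.2 * s} ⊆
        ((P ×ˢ P).image fun z => (z.2.1 - z.1.1) / (z.1.2 - z.2.2) : Finset ℝ) := by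
      rintro s ⟨p, hp, q, hq, hpq, h⟩
      refine Finset.mem_coe.2 (Finset.mem_image.2 ⟨(p, q), Finset.mk_mem_product hp hq, ?_⟩)
      have hne : p.2 - q.2 ≠ 0 := by
        intro h0
        refine hpq (Prod.ext ?_ (sub_eq_zero.1 h0))
        rw [sub_eq_zero.1 h0] at h
        linarith
      rw [div_eq_iff hne]
      linarith
    exact (Finset.finite_toSet _).subset this
  obtain ⟨s, hs⟩ := hfin.exists_notMem
  have hs' : ∀ p ∈ P, ∀ q ∈ P, p ≠ q → p.1 + p.2 * s ≠ q.1 + q.2 * s :=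
    fun p hp q hq hpq h => hs ⟨p, hp, q, hq, hpq, h⟩
  have hev : ∀ᶠ ε in nhdsWithin (0 : ℝ) (Set.Ioi 0), ∀ p ∈ P, ∀ q ∈ P,
      (dot p v < dot q v → dot p (v + ε • (1, s)) < dot q (v + ε • (1, s))) ∧
      (p ≠ q → dot p (v + ε • (1, s)) ≠ dot q (v + ε • (1, s))) := by
    rw [Filter.eventually_all_finset]
    intro p hp
    rw [Filter.eventually_all_finset]
    intro q hq
    have hlt : ∀ p q : ℝ × ℝ, dot p v < dot q v → ∀ᶠ ε in nhdsWithin (0 : ℝ) (Set.Ioi 0),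
        dot p (v + ε • (1, s)) < dot q (v + ε • (1, s)) := by
      intro p q h
      simp only [hadd]
      have hc : ContinuousAt (fun ε : ℝ => dot p v + ε * (p.1 + p.2 * s)) 0 := by fun_prop
      have hc' : ContinuousAt (fun ε : ℝ => dot q v + ε * (q.1 + q.2 * s)) 0 := by fun_prop
      exact (hc.eventually_lt hc' (by simpa using h)).filter_mono nhdsWithin_le_nhds
    rcases lt_trichotomy (dot p v) (dot q v) with h | h | h
    · filter_upwards [hlt p q h] with ε hε
      exact ⟨fun _ => hε, fun _ => hε.ne⟩
    · filter_upwards [self_mem_nhdsWithin] with ε hε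
      refine ⟨fun h' => absurd h h'.ne, fun hpq h' => hs' p hp q hq hpq ?_⟩
      rw [hadd, hadd, h] at h'
      exact mul_left_cancel₀ (ne_of_gt hε) (add_left_cancel h')
    · filter_upwards [hlt q p h] with ε hε
      exact ⟨fun h' => absurd h h'.not_gt, fun _ => hε.ne'⟩
  obtain ⟨ε, hε⟩ := hev.exists
  exact ⟨v + ε • (1, s), hX,
    fun p hp q hq h => by_contra fun hpq => (hε p hp q hq).2 hpq h,
    fun x hx p hp hpX => (hε x (hX hx) p hp).1 (hv x hx p hp hpX)⟩

/-- Contribution of the edges with first endpoint in an initial third. -/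
lemma sum_sq_class_ge {P X : Finset (ℝ × ℝ)} {v : ℝ × ℝ} (hP : GenPos P) (hX : X ⊆ P)
    (hv : ∀ x ∈ X, ∀ p ∈ P, p ∉ X → dot x v < dot p v) (hcard : P.card = 3 * X.card) :
    (10 * (X.card : ℝ) ^ 4 - 4 * (X.card : ℝ) ^ 2) / 3 +
      (2 / 3 * (X.card : ℝ) ^ 4 * (10 - Real.pi ^ 2) - 22 * (X.card : ℝ) ^ 3) ≤
      ∑ x ∈ X, ∑ p ∈ P.erase x, (2 * (leftCount P x p : ℝ) - (P.card - 2)) ^ 2 := by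
  obtain ⟨v', hX'⟩ := exists_isInitial hX hv
  have h1 := sum_sq_bichromatic hP hX' hcard
  have h2 : 2 / 3 * (X.card : ℝ) ^ 4 * (10 - Real.pi ^ 2) - 22 * (X.card : ℝ) ^ 3 ≤
      ∑ x ∈ X, ∑ y ∈ X.erase x, (2 * (leftCount P x y : ℝ) - (P.card - 2)) ^ 2 := by
    have hlim := (hasSum_one_div_mul_add_one_cube.tendsto_sum_nat.const_mul
      (2 / 3 * (X.card : ℝ) ^ 4)).sub_const (22 * (X.card : ℝ) ^ 3)
    exact le_of_tendsto' hlim (sum_sq_monochromatic_ge hP hX' hcard)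
  rw [← h1]
  refine (add_le_add_right h2 _).trans (le_of_eq ?_)
  rw [← Finset.sum_add_distrib]
  refine Finset.sum_congr rfl fun x hx => ?_
  have h3 : P.erase x = (P \ X) ∪ X.erase x := by
    ext p
    have hsub : p ∈ X → p ∈ P := fun h => hX h
    simp only [Finset.mem_erase, Finset.mem_union, Finset.mem_sdiff]
    by_cases hp : p ∈ X
    · simp [hp, hsub hp]
    · simp only [hp, not_false_eq_true, and_true, and_false, or_false]
      exact ⟨fun h => h.2, fun h => ⟨by rintro rfl; exact hp hx, h⟩⟩
  rw [h3, Finset.sum_union]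
  rw [Finset.disjoint_left]
  intro p hp hp'
  exact (Finset.mem_sdiff.1 hp).2 (Finset.mem_erase.1 hp').2

/-- Any 3-decomposable set of `n` points in general position determines at least
`(2/27)(15 − π²)·C(n,4) − c·n³` convex quadrilaterals, for an absolute constant `c > 0`. -/
theorem crossings_of_three_decomposable_lower_bound :
    ∃ c : ℝ, 0 < c ∧ ∀ n : ℕ, 0 < n → 3 ∣ n → ∀ P : Finset (ℝ × ℝ),
      P.card = n → GenPos P → ThreeDecompPts P →
      (2 / 27) * (15 - Real.pi ^ 2) * (n.choose 4 : ℝ) - c * (n : ℝ) ^ 3 ≤ (crNum P : ℝ) := by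
  refine ⟨10, by norm_num, ?_⟩
  rintro n hn - P hPn hP ⟨A, B, C, hAB, hAC, hBC, rfl, hA, hB, hC, v₁, v₂, v₃, -, -, -, -, -, -, hv⟩
  set P := A ∪ B ∪ C with hPdef
  have hBA : B.card = A.card := by omega
  have hCA : C.card = A.card := by omega
  have hApos : 0 < A.card := by omega
  obtain ⟨a₀, ha₀⟩ := Finset.card_pos.1 hApos
  obtain ⟨b₀, hb₀⟩ := Finset.card_pos.1 (hBA ▸ hApos)
  obtain ⟨c₀, hc₀⟩ := Finset.card_pos.1 (hCA ▸ hApos)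
  have hmem : ∀ p, p ∈ P ↔ p ∈ A ∨ p ∈ B ∨ p ∈ C := by
    intro p
    simp only [hPdef, Finset.mem_union, or_assoc]
  have hneg : ∀ p : ℝ × ℝ, dot p (-v₁) = -dot p v₁ := by
    intro p
    simp [dot]
    ring
  have sA := sum_sq_class_ge hP (X := A) (v := v₂) (fun p hp => (hmem p).2 (Or.inl hp)) (by
    intro a ha p hp hpA
    rcases (hmem p).1 hp with h | h | h
    · exact absurd h hpA
    · exact (hv a ha p h c₀ hc₀).2.2.1
    · exact (hv a ha b₀ hb₀ p h).2.2.1.trans (hv a ha b₀ hb₀ p h).2.2.2.1) hA.symm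
  have sB := sum_sq_class_ge hP (X := B) (v := v₁)
    (fun p hp => (hmem p).2 (Or.inr (Or.inl hp))) (by
    intro b hb p hp hpB
    rcases (hmem p).1 hp with h | h | h
    · exact (hv p h b hb c₀ hc₀).1
    · exact absurd h hpB
    · exact (hv a₀ ha₀ b hb p h).1.trans (hv a₀ ha₀ b hb p h).2.1) hB.symm
  have sC := sum_sq_class_ge hP (X := C) (v := -v₁)
    (fun p hp => (hmem p).2 (Or.inr (Or.inr hp))) (by
    intro c hc p hp hpC
    rw [hneg, hneg, neg_lt_neg_iff]
    rcases (hmem p).1 hp with h | h | h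
    · exact (hv p h b₀ hb₀ c hc).2.1
    · exact (hv a₀ ha₀ p h c hc).1.trans (hv a₀ ha₀ p h c hc).2.1
    · exact absurd h hpC) hC.symm
  have hcr := crNum_lower_bound hP
  have hsplit : ∀ g : ℝ × ℝ → ℝ, ∑ a ∈ P, g a = ∑ a ∈ A, g a + ∑ a ∈ B, g a + ∑ a ∈ C, g a := by
    intro g
    rw [hPdef, Finset.sum_union (Finset.disjoint_union_left.2 ⟨hAC, hBC⟩), Finset.sum_union hAB]
  rw [hsplit] at hcr
  rw [hBA] at sB
  rw [hCA] at sC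
  have hpi : 0 < 15 - Real.pi ^ 2 := by nlinarith [Real.pi_lt_four, Real.pi_pos, Real.pi_lt_d2]
  have hchoose : (n.choose 4 : ℝ) ≤ (n : ℝ) ^ 4 / 24 := by
    have := Nat.choose_le_pow_div (α := ℝ) 4 n
    simpa [Nat.factorial] using this
  have hn3 : (n : ℝ) = 3 * A.card := by
    rw [← hPn, ← hA]
    push_cast
    rfl
  have hPn' : (P.card : ℝ) = n := by exact_mod_cast hPn
  have hmain : (2 / 27) * (15 - Real.pi ^ 2) * (n.choose 4 : ℝ) ≤
      (15 - Real.pi ^ 2) / 4 * (A.card : ℝ) ^ 4 := by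
    refine (mul_le_mul_of_nonneg_left hchoose (by positivity)).trans (le_of_eq ?_)
    rw [hn3]
    ring
  have hm1 : (1 : ℝ) ≤ A.card := by exact_mod_cast hApos
  have hm23 : (A.card : ℝ) ^ 2 ≤ (A.card : ℝ) ^ 3 := pow_le_pow_right₀ hm1 (by norm_num)
  have hm0 : (0 : ℝ) ≤ (A.card : ℝ) ^ 3 := by positivity
  have hn3' : (n : ℝ) ^ 3 = 27 * (A.card : ℝ) ^ 3 := by rw [hn3]; ring
  have hP3 : (P.card : ℝ) ^ 3 = 27 * (A.card : ℝ) ^ 3 := by rw [hPn', hn3']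
  rw [hP3] at hcr
  rw [hn3']
  linarith
end

section
/- Let n be a positive integer divisible by 3, let Π be a 3-decomposable halfperiod on n elements, and let k be an integer with 1 ≤ k < n/2. Then the number N_{≤k}(Π) of (≤k)-critical transpositions of Π satisfies N_{≤k}(Π) ≥ B(k,n). -/
/-- A halfperiod on `n` elements: a sequence `pos 0, pos 1, …, pos (C(n,2))` of linear orderings
of `Fin n` (given by the position `pos t x` of element `x` at time `t`), where consecutive
orderings differ by transposing the elements in positions `move t` and `move t + 1`, and the
final ordering is the reverse of the initial one. Positions are numbered `0, …, n-1`, so the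
swap at step `t` is the paper's `(move t + 1)`-transposition. -/
structure Halfperiod (n : ℕ) where
  pos : ℕ → (Fin n ≃ Fin n)
  move : ℕ → ℕ
  move_lt : ∀ t, t < n.choose 2 → move t + 1 < n
  step : ∀ t, t < n.choose 2 → ∀ x : Fin n,
    ((pos (t + 1)) x : ℕ) =
      if ((pos t) x : ℕ) = move t then move t + 1
      else if ((pos t) x : ℕ) = move t + 1 then move t
      else ((pos t) x : ℕ)
  reverse : ∀ x : Fin n, ((pos (n.choose 2)) x : ℕ) = n - 1 - ((pos 0) x : ℕ)

/-- A halfperiod is 3-decomposable with wings `A`, `B`, `C` if the wings partition the ground set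
into three parts of size `n/3`, in the initial ordering all of `A` precedes all of `B`, which
precedes all of `C`, and there are indices `0 < s < t ≤ C(n,2)` such that at time `s+1` the
order of the wings is `B, A, C` and at time `t+1` it is `B, C, A`. -/
def Halfperiod.ThreeDecomp {n : ℕ} (H : Halfperiod n) (A B C : Finset (Fin n)) : Prop :=
  3 * A.card = n ∧ 3 * B.card = n ∧ 3 * C.card = n ∧
  Disjoint A B ∧ Disjoint A C ∧ Disjoint B C ∧ A ∪ B ∪ C = Finset.univ ∧
  (∀ a ∈ A, ∀ b ∈ B, H.pos 0 a < H.pos 0 b) ∧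
  (∀ b ∈ B, ∀ c ∈ C, H.pos 0 b < H.pos 0 c) ∧
  ∃ s t : ℕ, 0 < s ∧ s < t ∧ t ≤ n.choose 2 ∧
    (∀ b ∈ B, ∀ a ∈ A, H.pos (s + 1) b < H.pos (s + 1) a) ∧
    (∀ a ∈ A, ∀ c ∈ C, H.pos (s + 1) a < H.pos (s + 1) c) ∧
    (∀ b ∈ B, ∀ c ∈ C, H.pos (t + 1) b < H.pos (t + 1) c) ∧
    (∀ c ∈ C, ∀ a ∈ A, H.pos (t + 1) c < H.pos (t + 1) a)

/-- The transposition at step `t` is `(≤ k)`-critical: it is an `i`-transposition or an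
`(n-i)`-transposition for some `i ≤ k` (in the paper's 1-based indexing `i = move t + 1`). -/
def Halfperiod.CritAt {n : ℕ} (H : Halfperiod n) (k t : ℕ) : Prop :=
  H.move t + 1 ≤ k ∨ n - k ≤ H.move t + 1

/-- `NcritLe n k H` is the number of `(≤ k)`-critical transpositions of the halfperiod `H`. -/
noncomputable def NcritLe (n k : ℕ) (H : Halfperiod n) : ℕ :=
  Set.ncard {t : ℕ | t < n.choose 2 ∧ H.CritAt k t}

/-- The formal binomial coefficient `binom(r,2)` of a real number: `r(r-1)/2` if `r ≥ 2`,
and `0` otherwise. -/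
noncomputable def rbinom2 (r : ℝ) : ℝ := if 2 ≤ r then r * (r - 1) / 2 else 0

/-- `cseq j = 1/2 − 1/(3j(j+1))`. -/
noncomputable def cseq (j : ℕ) : ℝ := 1 / 2 - 1 / (3 * (j : ℝ) * ((j : ℝ) + 1))

/-- The lower bound `B(k,n)` (relative to the integer `s = s(k,n)`). -/
noncomputable def Bkn (k n s : ℕ) : ℝ :=
  3 * rbinom2 ((k : ℝ) + 1) + 3 * rbinom2 ((k : ℝ) + 1 - (n : ℝ) / 3) +
    3 * ∑ j ∈ Finset.Icc 2 (s - 1), (j : ℝ) * ((j : ℝ) + 1) *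
      rbinom2 ((k : ℝ) + 1 - cseq j * (n : ℝ))

namespace Halfperiod

variable {n : ℕ} (H : Halfperiod n)

/-- At step `t` the elements `x` and `y` are transposed, `x` moving to the right. -/
def Swaps (t : ℕ) (x y : Fin n) : Prop :=
  (H.pos t x : ℕ) = H.move t ∧ (H.pos t y : ℕ) = H.move t + 1

lemma exists_swaps_iff {t : ℕ} (ht : t < n.choose 2) :
    ∃ l r : Fin n, l ≠ r ∧ ∀ x y, H.Swaps t x y ↔ x = l ∧ y = r := by
  have h := H.move_lt t ht
  refine ⟨(H.pos t).symm ⟨H.move t, by omega⟩, (H.pos t).symm ⟨H.move t + 1, h⟩, ?_, ?_⟩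
  · intro he
    have := (H.pos t).symm.injective he
    simp at this
  · intro x y
    simp only [Swaps, Equiv.eq_symm_apply, Fin.ext_iff]

lemma exists_swaps_of_lt {x y : Fin n} (hxy : H.pos 0 x < H.pos 0 y) :
    ∃ t < n.choose 2, H.Swaps t x y := by
  by_contra! hcon
  have key : ∀ t ≤ n.choose 2, (H.pos t x : ℕ) < H.pos t y := by
    intro t
    induction t with
    | zero => intro _; exact hxy
    | succ t ih =>
      intro ht
      have h1 := ih (by omega)
      have h2 := hcon t (by omega)
      have hx := H.step t (by omega) x
      have hy := H.step t (by omega) y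
      simp only [Swaps, not_and] at h2
      split_ifs at hx hy <;> omega
  have h1 := key _ le_rfl
  have h2 := H.reverse x
  have h3 := H.reverse y
  have h4 : (H.pos 0 x : ℕ) < H.pos 0 y := hxy
  omega

open Classical in
/-- The number (`0` or `1`) of times step `t` transposes `x` and `y`. -/
noncomputable def stepWeight (t : ℕ) (x y : Fin n) : ℤ :=
  (if H.Swaps t x y then 1 else 0) + (if H.Swaps t y x then 1 else 0)

/-- The number of steps in `S` that transpose `x` and `y`. -/
noncomputable def swapCount (S : Finset ℕ) (x y : Fin n) : ℤ :=
  ∑ t ∈ S, H.stepWeight t x y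

lemma stepWeight_nonneg (t : ℕ) (x y : Fin n) : 0 ≤ H.stepWeight t x y := by
  unfold stepWeight
  split_ifs <;> norm_num

lemma swapCount_nonneg (S : Finset ℕ) (x y : Fin n) : 0 ≤ H.swapCount S x y :=
  Finset.sum_nonneg fun t _ => H.stepWeight_nonneg t x y

lemma swapCount_comm (S : Finset ℕ) (x y : Fin n) : H.swapCount S x y = H.swapCount S y x :=
  Finset.sum_congr rfl fun _ _ => add_comm _ _

lemma sum_stepWeight {t : ℕ} (ht : t < n.choose 2) : ∑ x, ∑ y, H.stepWeight t x y = 2 := by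
  obtain ⟨l, r, -, h⟩ := H.exists_swaps_iff ht
  simp [stepWeight, h, Finset.sum_add_distrib, ite_and]

lemma sum_swapCount {S : Finset ℕ} (hS : S ⊆ Finset.range (n.choose 2)) :
    ∑ x, ∑ y, H.swapCount S x y = 2 * (S.card : ℤ) := by
  have h1 : ∑ x, ∑ y, H.swapCount S x y = ∑ t ∈ S, ∑ x, ∑ y, H.stepWeight t x y := by
    unfold swapCount
    simp only [Finset.sum_comm (t := S)]
  rw [h1, Finset.sum_congr rfl fun t ht => H.sum_stepWeight (Finset.mem_range.1 (hS ht))]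
  simp [mul_comm]

lemma one_le_swapCount {x y : Fin n} (hxy : x ≠ y) :
    1 ≤ H.swapCount (Finset.range (n.choose 2)) x y := by
  wlog hlt : H.pos 0 x < H.pos 0 y generalizing x y
  · rw [swapCount_comm]
    refine this hxy.symm (lt_of_le_of_ne (not_lt.1 hlt) fun h => hxy ?_)
    exact ((H.pos 0).injective h).symm
  obtain ⟨t, ht, hs⟩ := H.exists_swaps_of_lt hlt
  refine le_trans ?_ (Finset.single_le_sum (fun t _ => H.stepWeight_nonneg t x y)
    (Finset.mem_range.2 ht))
  unfold stepWeight
  rw [if_pos hs]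
  split_ifs <;> norm_num

lemma swapCount_range (x y : Fin n) :
    H.swapCount (Finset.range (n.choose 2)) x y = if x = y then 0 else 1 := by
  have hle : ∀ p ∈ (Finset.univ : Finset (Fin n × Fin n)), (if p.1 = p.2 then (0 : ℤ) else 1) ≤
      H.swapCount (Finset.range (n.choose 2)) p.1 p.2 := by
    intro p _
    split_ifs with h
    · exact H.swapCount_nonneg _ _ _
    · exact H.one_le_swapCount h
  have hsum : ∑ p : Fin n × Fin n, (if p.1 = p.2 then (0 : ℤ) else 1) =
      ∑ p : Fin n × Fin n, H.swapCount (Finset.range (n.choose 2)) p.1 p.2 := by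
    rw [Fintype.sum_prod_type, Fintype.sum_prod_type, H.sum_swapCount subset_rfl]
    have h1 : ∀ a b : Fin n, (if a = b then (0 : ℤ) else 1) = 1 - if a = b then 1 else 0 := by
      intro a b
      split_ifs <;> norm_num
    have h2 : (n.choose 2 : ℤ) * 2 = n * (n - 1) := by
      rcases n with _ | n
      · simp
      · have h3 := Nat.choose_two_right (n + 1)
        have h4 := Nat.div_mul_cancel (Nat.even_mul_pred_self (n + 1)).two_dvd
        rw [← h3] at h4
        push_cast
        have : ((n + 1).choose 2 * 2 : ℤ) = (n + 1) * n := by exact_mod_cast h4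
        linarith
    simp only [h1, Finset.sum_sub_distrib, Finset.sum_ite_eq, Finset.sum_const, Finset.card_univ,
      Fintype.card_fin, Finset.card_range, Finset.mem_univ, if_true, nsmul_eq_mul]
    linarith
  exact ((Finset.sum_eq_sum_iff_of_le hle).1 hsum (x, y) (Finset.mem_univ _)).symm

lemma swapCount_le_one {S : Finset ℕ} (hS : S ⊆ Finset.range (n.choose 2)) (x y : Fin n) :
    H.swapCount S x y ≤ 1 := by
  refine (Finset.sum_le_sum_of_subset_of_nonneg hS
    fun t _ _ => H.stepWeight_nonneg t x y).trans ?_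
  have := H.swapCount_range x y
  unfold swapCount at this
  rw [this]
  split_ifs <;> norm_num

open Classical in
/-- The set of `(≤ k)`-critical steps. -/
noncomputable def critSteps (k : ℕ) : Finset ℕ :=
  (Finset.range (n.choose 2)).filter fun t => H.CritAt k t

lemma critSteps_subset (k : ℕ) : H.critSteps k ⊆ Finset.range (n.choose 2) := by
  classical exact Finset.filter_subset _ _

lemma ncritLe_eq_card (k : ℕ) : NcritLe n k H = (H.critSteps k).card := by
  unfold NcritLe critSteps
  rw [← Set.ncard_coe_finset]
  simp

/-- The number of `(≤ k)`-critical levels among the first `q`. -/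
def critDepth (n k q : ℕ) : ℤ := ((min q k + (q - (n - k - 1)) : ℕ) : ℤ)

lemma critDepth_add_reverse {k q : ℕ} (hk : 2 * k < n) (hq : q < n) :
    critDepth n k (n - 1 - q) + critDepth n k q = 2 * k := by
  unfold critDepth
  omega

open Classical in
lemma abs_critDepth_step_le {k t : ℕ} (hk : 2 * k < n) (ht : t < n.choose 2)
    (F : Finset (Fin n)) :
    |∑ x ∈ F, critDepth n k (H.pos (t + 1) x) - ∑ x ∈ F, critDepth n k (H.pos t x)| ≤
      if H.CritAt k t then ∑ x ∈ F, ∑ y ∈ Fᶜ, H.stepWeight t x y else 0 := by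
  obtain ⟨l, r, hlr, h⟩ := H.exists_swaps_iff ht
  have hl : H.Swaps t l r := (h l r).2 ⟨rfl, rfl⟩
  set g : ℤ := if H.CritAt k t then 1 else 0 with hg
  have hdiff : ∀ x, critDepth n k (H.pos (t + 1) x) - critDepth n k (H.pos t x) =
      (if x = l then g else 0) - (if x = r then g else 0) := by
    intro x
    have hs := H.step t ht x
    have hm := H.move_lt t ht
    have hcrit : g = critDepth n k (H.move t + 1) - critDepth n k (H.move t) := by
      rw [hg]
      unfold critDepth CritAt
      split_ifs <;> omega
    by_cases hxl : x = l
    · subst hxl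
      rw [if_pos hl.1] at hs
      rw [hs, hl.1, if_pos rfl, if_neg hlr, hcrit, sub_zero]
    · by_cases hxr : x = r
      · subst hxr
        have h2 : (H.pos t x : ℕ) = H.move t + 1 := hl.2
        rw [if_neg (by omega), if_pos h2] at hs
        rw [hs, h2, if_pos rfl, if_neg hxl, hcrit]
        ring
      · have h1 : (H.pos t x : ℕ) ≠ H.move t := fun he =>
          hxl ((H.pos t).injective (Fin.ext (he.trans hl.1.symm)))
        have h2 : (H.pos t x : ℕ) ≠ H.move t + 1 := fun he =>
          hxr ((H.pos t).injective (Fin.ext (he.trans hl.2.symm)))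
        rw [if_neg h1, if_neg h2] at hs
        rw [hs, if_neg hxl, if_neg hxr]
        ring
  have hw : ∑ x ∈ F, ∑ y ∈ Fᶜ, H.stepWeight t x y =
      (if l ∈ F ∧ r ∉ F then 1 else 0) + (if r ∈ F ∧ l ∉ F then 1 else 0) := by
    have e1 : ∀ x y, H.stepWeight t x y =
        (if x = l then if y = r then 1 else 0 else 0) +
        (if x = r then if y = l then 1 else 0 else 0) := by
      intro x y
      simp only [stepWeight, h, ite_and]
      congr 1
      split_ifs <;> rfl
    have e2 : ∀ a b : Fin n, ∑ x ∈ F, ∑ y ∈ Fᶜ,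
        (if x = a then if y = b then (1 : ℤ) else 0 else 0) = if a ∈ F ∧ b ∉ F then 1 else 0 := by
      intro a b
      have : ∀ x, ∑ y ∈ Fᶜ, (if x = a then if y = b then (1 : ℤ) else 0 else 0) =
          if x = a then if b ∉ F then 1 else 0 else 0 := by
        intro x
        split_ifs <;> simp_all
      simp only [this, Finset.sum_ite_eq', ite_and]
    simp only [e1, Finset.sum_add_distrib, e2]
  rw [← Finset.sum_sub_distrib, Finset.sum_congr rfl fun x _ => hdiff x, hw,
    Finset.sum_sub_distrib, Finset.sum_ite_eq', Finset.sum_ite_eq', hg]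
  split_ifs <;> simp_all

/-- A lower bound for the number of critical transpositions across a cut. -/
lemma le_sum_swapCount_compl {k T : ℕ} (hk : 2 * k < n) (hT : T ≤ n.choose 2)
    (F : Finset (Fin n)) :
    ∑ x ∈ F, (2 * (k : ℤ) - 2 * critDepth n k (H.pos T x)) ≤
      ∑ x ∈ F, ∑ y ∈ Fᶜ, H.swapCount (H.critSteps k) x y := by
  classical
  set Ψ : ℕ → ℤ := fun t => ∑ x ∈ F, critDepth n k (H.pos t x) with hΨ
  set u : ℕ → ℤ := fun t =>
    if H.CritAt k t then ∑ x ∈ F, ∑ y ∈ Fᶜ, H.stepWeight t x y else 0 with hu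
  have hstep : ∀ t < n.choose 2, |Ψ (t + 1) - Ψ t| ≤ u t := fun t ht =>
    H.abs_critDepth_step_le hk ht F
  have htot : ∑ x ∈ F, ∑ y ∈ Fᶜ, H.swapCount (H.critSteps k) x y =
      ∑ t ∈ Finset.range (n.choose 2), u t := by
    rw [hu, ← Finset.sum_filter]
    have : ∑ x ∈ F, ∑ y ∈ Fᶜ, H.swapCount (H.critSteps k) x y =
        ∑ t ∈ H.critSteps k, ∑ x ∈ F, ∑ y ∈ Fᶜ, H.stepWeight t x y := by
      unfold swapCount
      simp only [Finset.sum_comm (t := H.critSteps k)]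
    rw [this]
    congr!
  have hdown : Ψ 0 - Ψ T ≤ ∑ t ∈ Finset.range T, u t := by
    rw [← Finset.sum_range_sub']
    refine Finset.sum_le_sum fun t ht => ?_
    have := abs_le.1 (hstep t ((Finset.mem_range.1 ht).trans_le hT))
    linarith [this.1]
  have hup : Ψ (n.choose 2) - Ψ T ≤ ∑ t ∈ Finset.Ico T (n.choose 2), u t := by
    rw [← Finset.sum_Ico_sub _ hT]
    refine Finset.sum_le_sum fun t ht => ?_
    exact (abs_le.1 (hstep t (Finset.mem_Ico.1 ht).2)).2
  have hsum : Ψ (n.choose 2) + Ψ 0 = ∑ x ∈ F, 2 * (k : ℤ) := by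
    rw [hΨ]
    dsimp only
    rw [← Finset.sum_add_distrib]
    refine Finset.sum_congr rfl fun x _ => ?_
    rw [H.reverse x]
    exact critDepth_add_reverse hk (H.pos 0 x).isLt
  rw [htot, ← Finset.sum_range_add_sum_Ico u hT, Finset.sum_sub_distrib, ← hsum,
    ← Finset.mul_sum]
  change Ψ (n.choose 2) + Ψ 0 - 2 * Ψ T ≤ _
  linarith

/-- The set of the first `p` elements at time `T`. -/
def initSeg (T p : ℕ) : Finset (Fin n) := Finset.univ.filter fun x => (H.pos T x : ℕ) < p

lemma sum_initSeg (T : ℕ) {p : ℕ} (hp : p ≤ n) (f : ℕ → ℤ) :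
    ∑ x ∈ H.initSeg T p, f (H.pos T x) = ∑ i ∈ Finset.range p, f i := by
  refine Finset.sum_bij (fun x _ => (H.pos T x : ℕ)) ?_ ?_ ?_ ?_
  · intro x hx
    simpa [initSeg] using hx
  · intro x _ y _ h
    exact (H.pos T).injective (Fin.ext h)
  · intro i hi
    have hi' := Finset.mem_range.1 hi
    exact ⟨(H.pos T).symm ⟨i, by omega⟩, by simp [initSeg, hi'], by simp⟩
  · intro x _
    rfl

lemma card_initSeg (T : ℕ) {p : ℕ} (hp : p ≤ n) : (H.initSeg T p).card = p := by
  have := H.sum_initSeg T hp fun _ => 1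
  simpa using this

lemma initSeg_subset (T : ℕ) {p q : ℕ} (hpq : p ≤ q) : H.initSeg T p ⊆ H.initSeg T q := by
  intro x hx
  simp only [initSeg, Finset.mem_filter] at hx ⊢
  exact ⟨hx.1, hx.2.trans_le hpq⟩

lemma eq_initSeg {T m : ℕ} {X : Finset (Fin n)} (hm : X.card = m)
    (hX : ∀ x ∈ X, ∀ y ∉ X, H.pos T x < H.pos T y) : X = H.initSeg T m := by
  subst hm
  refine Finset.eq_of_subset_of_card_le (fun x hx => ?_) ?_
  · have hsub : H.initSeg T (H.pos T x + 1) ⊆ X := by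
      intro z hz
      by_contra hzX
      have h1 := Fin.lt_def.1 (hX x hx z hzX)
      simp only [initSeg, Finset.mem_filter] at hz
      omega
    have := Finset.card_le_card hsub
    rw [H.card_initSeg T (H.pos T x).isLt] at this
    simp only [initSeg, Finset.mem_filter, Finset.mem_univ, true_and]
    omega
  · rw [H.card_initSeg T (by simpa using Finset.card_le_univ X)]

lemma sum_critDepth_of_le {k p : ℕ} (hk : 2 * k < n) (hp : p ≤ k) :
    ∑ i ∈ Finset.range p, (2 * (k : ℤ) - 2 * critDepth n k i) = p * (2 * k + 1 - p) := by
  induction p with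
  | zero => simp
  | succ p ih =>
    have : critDepth n k p = p := by unfold critDepth; omega
    rw [Finset.sum_range_succ, ih (by omega), this]
    push_cast
    ring

lemma sum_critDepth_of_ge {k p : ℕ} (hk : 2 * k < n) (hp : k ≤ p) (hpn : p ≤ n - k) :
    ∑ i ∈ Finset.range p, (2 * (k : ℤ) - 2 * critDepth n k i) = k * (k + 1) := by
  induction p, hp using Nat.le_induction with
  | base => rw [sum_critDepth_of_le hk le_rfl]; ring
  | succ p hp ih =>
    have : critDepth n k p = k := by unfold critDepth; omega
    rw [Finset.sum_range_succ, ih (by omega), this]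
    ring

/-- The number of ordered pairs in `U × V` whose transposition is `(≤ k)`-critical. -/
noncomputable def critPairs (k : ℕ) (U V : Finset (Fin n)) : ℤ :=
  ∑ x ∈ U, ∑ y ∈ V, H.swapCount (H.critSteps k) x y

lemma critPairs_nonneg (k : ℕ) (U V : Finset (Fin n)) : 0 ≤ H.critPairs k U V :=
  Finset.sum_nonneg fun _ _ => Finset.sum_nonneg fun _ _ => H.swapCount_nonneg _ _ _

lemma critPairs_comm (k : ℕ) (U V : Finset (Fin n)) :
    H.critPairs k U V = H.critPairs k V U := by
  unfold critPairs
  rw [Finset.sum_comm]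
  simp only [H.swapCount_comm (H.critSteps k)]

lemma critPairs_le (k : ℕ) (U V : Finset (Fin n)) :
    H.critPairs k U V ≤ U.card * V.card := by
  refine (Finset.sum_le_sum fun x _ => Finset.sum_le_sum fun y _ =>
    H.swapCount_le_one (H.critSteps_subset k) x y).trans ?_
  simp

lemma critPairs_union_left (k : ℕ) {U V : Finset (Fin n)} (W : Finset (Fin n))
    (h : Disjoint U V) :
    H.critPairs k (U ∪ V) W = H.critPairs k U W + H.critPairs k V W :=
  Finset.sum_union h

lemma critPairs_union_right (k : ℕ) (W : Finset (Fin n)) {U V : Finset (Fin n)}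
    (h : Disjoint U V) :
    H.critPairs k W (U ∪ V) = H.critPairs k W U + H.critPairs k W V := by
  rw [critPairs_comm, critPairs_union_left _ _ _ h, critPairs_comm, H.critPairs_comm k V]

lemma critPairs_univ (k : ℕ) :
    H.critPairs k Finset.univ Finset.univ = 2 * (NcritLe n k H : ℤ) := by
  rw [ncritLe_eq_card]
  exact H.sum_swapCount (H.critSteps_subset k)

lemma critPairs_initSeg_compl_of_le {k T p : ℕ} (hk : 2 * k < n) (hT : T ≤ n.choose 2)
    (hp : p ≤ k) :
    (p : ℤ) * (2 * k + 1 - p) ≤ H.critPairs k (H.initSeg T p) (H.initSeg T p)ᶜ := by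
  rw [← sum_critDepth_of_le hk hp,
    ← H.sum_initSeg T (by omega) fun i => 2 * (k : ℤ) - 2 * critDepth n k i]
  exact H.le_sum_swapCount_compl hk hT _

lemma critPairs_initSeg_compl_of_ge {k T p : ℕ} (hk : 2 * k < n) (hT : T ≤ n.choose 2)
    (hp : k ≤ p) (hpn : p ≤ n - k) :
    (k : ℤ) * (k + 1) ≤ H.critPairs k (H.initSeg T p) (H.initSeg T p)ᶜ := by
  rw [← sum_critDepth_of_ge hk hp hpn,
    ← H.sum_initSeg T (by omega) fun i => 2 * (k : ℤ) - 2 * critDepth n k i]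
  exact H.le_sum_swapCount_compl hk hT _

lemma critPairs_initSeg_recursion {k T a b : ℕ} (hk : 2 * k < n) (hT : T ≤ n.choose 2)
    (hb : b ≤ k) (hba : b ≤ a) (ha : a ≤ n) :
    H.critPairs k (H.initSeg T b) (H.initSeg T b) + 2 * (b * (a - b - (n - 1 - 2 * k))) ≤
      H.critPairs k (H.initSeg T a) (H.initSeg T a) := by
  set F := H.initSeg T b
  set G := H.initSeg T a
  have hFG : F ⊆ G := H.initSeg_subset T hba
  have hG : F ∪ G \ F = G := Finset.union_sdiff_of_subset hFG
  have hFc : G \ F ∪ Gᶜ = Fᶜ := by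
    ext x
    have := @hFG x
    simp only [Finset.mem_union, Finset.mem_sdiff, Finset.mem_compl]
    tauto
  have hd1 : Disjoint F (G \ F) := Finset.disjoint_sdiff
  have hd2 : Disjoint (G \ F) Gᶜ :=
    (disjoint_compl_right (a := G)).mono_left Finset.sdiff_subset
  have h1 : H.critPairs k G G = H.critPairs k F F + H.critPairs k F (G \ F) +
      (H.critPairs k F (G \ F) + H.critPairs k (G \ F) (G \ F)) := by
    conv_lhs => rw [← hG]
    rw [H.critPairs_union_left k _ hd1, H.critPairs_union_right k _ hd1,
      H.critPairs_union_right k _ hd1, H.critPairs_comm k (G \ F) F]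
  have h2 := H.critPairs_initSeg_compl_of_le hk hT hb
  have h3 : H.critPairs k F Fᶜ = H.critPairs k F (G \ F) + H.critPairs k F Gᶜ := by
    rw [← hFc, H.critPairs_union_right k _ hd2]
  have h4 := H.critPairs_le k F Gᶜ
  have h5 := H.critPairs_nonneg k (G \ F) (G \ F)
  rw [Finset.card_compl, Fintype.card_fin, H.card_initSeg T ha, H.card_initSeg T (by omega),
    Nat.cast_sub ha] at h4
  change _ ≤ H.critPairs k F Fᶜ at h2
  nlinarith

end Halfperiod

/-- The value of the `L`-step recursion, `∑ j ≤ L, j(j+1) binom(a/(j(j+1)) - (w-1)/2, 2)`. -/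
noncomputable def chainBound (w : ℝ) (L : ℕ) (a : ℝ) : ℝ :=
  a ^ 2 * L / (2 * (L + 1)) - a * w * L / 2 + (w ^ 2 - 1) * (L * (L + 1) * (L + 2)) / 24

lemma chainBound_succ (w : ℝ) (L : ℕ) (a : ℝ) :
    chainBound w (L + 1) a = chainBound w L a +
      ((L : ℝ) + 1) * (L + 2) * ((a / ((L + 1) * (L + 2)) - (w - 1) / 2) *
        (a / ((L + 1) * (L + 2)) - (w - 1) / 2 - 1) / 2) := by
  unfold chainBound
  have h1 : (L : ℝ) + 1 ≠ 0 := by positivity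
  have h2 : (L : ℝ) + 2 ≠ 0 := by positivity
  push_cast
  rw [show (L : ℝ) + 1 + 1 = L + 2 by ring, show (L : ℝ) + 1 + 2 = L + 3 by ring]
  field_simp
  ring

lemma chainBound_rounding (w : ℝ) (L : ℕ) (a b : ℝ)
    (hb : |((L : ℝ) + 1) * (a / (L + 2) - w / 2) - b| ≤ 1 / 2) :
    chainBound w (L + 1) a ≤ chainBound w L b + b * (a - b - w) := by
  have h1 : (0 : ℝ) < (L : ℝ) + 1 := by positivity
  have h2 : (L : ℝ) + 2 ≠ 0 := by positivity
  set d := ((L : ℝ) + 1) * (a / (L + 2) - w / 2) - b with hd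
  have hd2 : d ^ 2 ≤ 1 / 4 := by nlinarith [abs_le.1 hb]
  have key : chainBound w L b + b * (a - b - w) - chainBound w (L + 1) a =
      ((L : ℝ) + 1) * (L + 2) / 8 - (L + 2) / (2 * (L + 1)) * d ^ 2 := by
    unfold chainBound
    rw [hd]
    push_cast
    rw [show (L : ℝ) + 1 + 1 = L + 2 by ring, show (L : ℝ) + 1 + 2 = L + 3 by ring]
    field_simp
    ring
  have h3 : (L + 2 : ℝ) / (2 * (L + 1)) * d ^ 2 ≤ (L + 2) / (2 * (L + 1)) * (1 / 4) := by
    gcongr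
  have h4 : (L + 2 : ℝ) / (2 * (L + 1)) * (1 / 4) ≤ ((L : ℝ) + 1) * (L + 2) / 8 := by
    rw [div_mul_div_comm, div_le_div_iff₀ (by positivity) (by norm_num)]
    have : (0 : ℝ) ≤ L := by positivity
    nlinarith [mul_nonneg this this, mul_nonneg this (mul_nonneg this this)]
  linarith

lemma chainBound_le_of_recursion {f : ℕ → ℝ} {w K : ℕ} (hf : ∀ a, 0 ≤ f a)
    (hrec : ∀ a b : ℕ, b ≤ a → a ≤ K → f b + b * ((a : ℝ) - b - w) ≤ f a) (L a : ℕ)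
    (haK : a ≤ K) (ha : (w : ℝ) * (L * (L + 1)) / 2 ≤ a) :
    chainBound w L a ≤ f a := by
  induction L generalizing a with
  | zero => simpa [chainBound] using hf a
  | succ L ih =>
    push_cast at ha
    set y : ℝ := ((L : ℝ) + 1) * (a / (L + 2) - w / 2) with hy
    have hL : (0 : ℝ) ≤ L := by positivity
    have hw : (0 : ℝ) ≤ w := by positivity
    have hdiv : (w : ℝ) * (L + 1) / 2 ≤ a / (L + 2) := by
      rw [le_div_iff₀ (by positivity)]
      linarith
    have hylow : ((w * (L + 1).choose 2 : ℕ) : ℝ) ≤ y := by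
      have : (((L + 1).choose 2 : ℕ) : ℝ) = (L + 1) * L / 2 := by
        rw [Nat.cast_choose_two]
        push_cast
        ring
      push_cast
      rw [this, hy]
      nlinarith
    have hyhigh : y ≤ a := by
      have h1 : y ≤ ((L : ℝ) + 1) * (a / (L + 2)) := by
        rw [hy]
        gcongr
        linarith
      refine h1.trans ?_
      rw [mul_div_assoc', div_le_iff₀ (by positivity)]
      have : (0 : ℝ) ≤ a := by positivity
      nlinarith
    have hrlow : ((w * (L + 1).choose 2 : ℕ) : ℤ) ≤ round y := by
      rw [round_eq, Int.le_floor]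
      push_cast at hylow ⊢
      linarith
    obtain ⟨b, hb⟩ := Int.eq_ofNat_of_zero_le ((Int.natCast_nonneg _).trans hrlow)
    have habs : |y - b| ≤ 1 / 2 := by
      have := abs_sub_round y
      rw [hb] at this
      exact_mod_cast this
    have hba : b ≤ a := by
      have h1 := (abs_le.1 habs).1
      have : (b : ℝ) < a + 1 := by linarith
      exact Nat.lt_succ_iff.1 (by exact_mod_cast this)
    have hbw : (w : ℝ) * (L * (L + 1)) / 2 ≤ b := by
      rw [hb] at hrlow
      have h1 : ((w * (L + 1).choose 2 : ℕ) : ℝ) ≤ b := by exact_mod_cast hrlow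
      push_cast [Nat.cast_choose_two] at h1
      linarith
    calc chainBound w (L + 1) a ≤ chainBound w L b + b * ((a : ℝ) - b - w) :=
          chainBound_rounding _ _ _ _ habs
      _ ≤ f b + b * ((a : ℝ) - b - w) := by
          have := ih b (hba.trans haK) hbw
          linarith
      _ ≤ f a := hrec a b hba haK

lemma rbinom2_le {r : ℝ} (hr : 1 ≤ r) : rbinom2 r ≤ r * (r - 1) / 2 := by
  unfold rbinom2
  split_ifs
  · exact le_rfl
  · have : 0 ≤ r * (r - 1) := mul_nonneg (by linarith) (by linarith)
    linarith

lemma rbinom2_of_lt {r : ℝ} (hr : r < 2) : rbinom2 r = 0 := if_neg (not_le.2 hr)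

lemma rbinom2_natCast (p : ℕ) : rbinom2 ((p : ℝ) + 1) = (p + 1) * p / 2 := by
  unfold rbinom2
  split_ifs with h
  · ring
  · have : (p : ℝ) < 1 := by linarith
    have : p = 0 := by
      have : p < 1 := by exact_mod_cast this
      omega
    simp [this]

lemma sum_le_chainBound {m w : ℝ} (hm : 0 ≤ m) {L : ℕ} (hL1 : 1 ≤ L)
    (hL : 1 ≤ m / (L * (L + 1)) - (w - 1) / 2) :
    ∑ j ∈ Finset.Icc 2 L, (j : ℝ) * (j + 1) * rbinom2 (m / (j * (j + 1)) - (w - 1) / 2) ≤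
      chainBound w L m - chainBound w 1 m := by
  induction L, hL1 using Nat.le_induction with
  | base => simp
  | succ L hL1 ih =>
    have hLpos : (1 : ℝ) ≤ L := by exact_mod_cast hL1
    have hmono : m / (((L + 1 : ℕ) : ℝ) * ((L + 1 : ℕ) + 1)) ≤ m / (L * (L + 1)) := by
      push_cast
      gcongr <;> linarith
    rw [Finset.sum_Icc_succ_top (by omega), chainBound_succ]
    have h1 := ih (by linarith)
    have h2 := rbinom2_le hL
    push_cast at h2 ⊢
    rw [show (L : ℝ) + 1 + 1 = L + 2 by ring] at h2 ⊢
    have h3 := mul_le_mul_of_nonneg_left h2 (show (0 : ℝ) ≤ (L + 1) * (L + 2) by positivity)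
    linarith

/-- The sum in `B(k,n)` is at most the bound given by a suitable number of recursion steps. -/
lemma exists_sum_le_chainBound {m w : ℝ} (hwm : w + 1 ≤ m) (hm : 0 ≤ m) (s : ℕ) :
    ∃ L : ℕ, 1 ≤ L ∧ 1 ≤ m / (L * (L + 1)) - (w - 1) / 2 ∧
      ∑ j ∈ Finset.Icc 2 s, (j : ℝ) * (j + 1) * rbinom2 (m / (j * (j + 1)) - (w - 1) / 2) ≤
        chainBound w L m - chainBound w 1 m := by
  induction s with
  | zero =>
    refine ⟨1, le_rfl, ?_, by simp⟩
    norm_num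
    linarith
  | succ s ih =>
    by_cases h : 2 ≤ m / (((s + 1 : ℕ) : ℝ) * ((s + 1 : ℕ) + 1)) - (w - 1) / 2
    · have h1 : 1 ≤ m / (((s + 1 : ℕ) : ℝ) * ((s + 1 : ℕ) + 1)) - (w - 1) / 2 := by linarith
      exact ⟨s + 1, by omega, h1, sum_le_chainBound hm (by omega) h1⟩
    · obtain ⟨L, hL1, hL, hsum⟩ := ih
      refine ⟨L, hL1, hL, ?_⟩
      rcases s with _ | s
      · simpa using hsum
      · rw [Finset.sum_Icc_succ_top (by omega), rbinom2_of_lt (not_le.1 h)]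
        linarith

lemma Bkn_of_lt {k m : ℕ} (s : ℕ) (hkm : k < m) :
    Bkn k (3 * m) s = 3 * ((k + 1) * k / 2) := by
  have hkmR : (k : ℝ) + 1 ≤ m := by exact_mod_cast hkm
  have hsum : ∑ j ∈ Finset.Icc 2 (s - 1), (j : ℝ) * ((j : ℝ) + 1) *
      rbinom2 ((k : ℝ) + 1 - cseq j * ((3 * m : ℕ) : ℝ)) = 0 := by
    refine Finset.sum_eq_zero fun j hj => ?_
    have hj2 : (2 : ℝ) ≤ j := by exact_mod_cast (Finset.mem_Icc.1 hj).1
    have hc : 1 / 3 ≤ cseq j := by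
      have : 1 / (3 * (j : ℝ) * (j + 1)) ≤ 1 / 6 :=
        one_div_le_one_div_of_le (by norm_num) (by nlinarith)
      unfold cseq
      linarith
    rw [rbinom2_of_lt, mul_zero]
    push_cast
    nlinarith
  rw [Bkn, hsum, rbinom2_natCast, rbinom2_of_lt]
  · ring
  · push_cast
    linarith

lemma Bkn_of_ge {k m : ℕ} (s : ℕ) (hkm : m ≤ k) :
    Bkn k (3 * m) s = 3 * ((k + 1) * k / 2) + 3 * ((k - m + 1) * (k - m) / 2) +
      3 * ∑ j ∈ Finset.Icc 2 (s - 1), (j : ℝ) * (j + 1) *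
        rbinom2 (m / (j * (j + 1)) - ((3 * m - 1 - 2 * k : ℝ) - 1) / 2) := by
  have hmid : rbinom2 ((k : ℝ) + 1 - ((3 * m : ℕ) : ℝ) / 3) = (k - m + 1) * (k - m) / 2 := by
    rw [← Nat.cast_sub hkm, ← rbinom2_natCast, Nat.cast_sub hkm]
    congr 1
    push_cast
    ring
  have hsum : ∀ j ∈ Finset.Icc 2 (s - 1), (j : ℝ) * ((j : ℝ) + 1) *
      rbinom2 ((k : ℝ) + 1 - cseq j * ((3 * m : ℕ) : ℝ)) = (j : ℝ) * (j + 1) *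
        rbinom2 (m / (j * (j + 1)) - ((3 * m - 1 - 2 * k : ℝ) - 1) / 2) := by
    intro j hj
    have hj2 : (2 : ℝ) ≤ j := by exact_mod_cast (Finset.mem_Icc.1 hj).1
    congr 2
    unfold cseq
    push_cast
    field_simp
    ring
  rw [Bkn, hmid, Finset.sum_congr rfl hsum, rbinom2_natCast]

namespace Halfperiod

lemma critPairs_univ_right {n : ℕ} (H : Halfperiod n) (k : ℕ) (X : Finset (Fin n)) :
    H.critPairs k X Finset.univ = H.critPairs k X X + H.critPairs k X Xᶜ := by
  rw [← H.critPairs_union_right k X disjoint_compl_right, Finset.union_compl]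

lemma two_mul_chainBound_le {n : ℕ} (H : Halfperiod n) {k T m w L : ℕ}
    (hw : w + 2 * k + 1 = n) (hT : T ≤ n.choose 2) (hmk : m ≤ k) (hmn : m ≤ n)
    (hL : (w : ℝ) * (L * (L + 1)) / 2 ≤ m) :
    2 * chainBound w L m ≤ H.critPairs k (H.initSeg T m) (H.initSeg T m) := by
  have h := chainBound_le_of_recursion
    (f := fun a => (H.critPairs k (H.initSeg T a) (H.initSeg T a) : ℝ) / 2) (w := w) (K := m)
    (fun a => ?_) (fun a b hba ham => ?_) L m le_rfl hL
  · linarith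
  · have := H.critPairs_nonneg k (H.initSeg T a) (H.initSeg T a)
    have : (0 : ℝ) ≤ H.critPairs k (H.initSeg T a) (H.initSeg T a) := by exact_mod_cast this
    positivity
  · have h1 := H.critPairs_initSeg_recursion (k := k) (by omega) hT
      (hba.trans (ham.trans hmk)) hba (ham.trans hmn)
    have h2 : (n : ℤ) - 1 - 2 * k = w := by omega
    rw [h2] at h1
    have h3 : (H.critPairs k (H.initSeg T b) (H.initSeg T b) : ℝ) +
        2 * (b * (a - b - w)) ≤ H.critPairs k (H.initSeg T a) (H.initSeg T a) := by
      exact_mod_cast h1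
    linarith

end Halfperiod

/-- For a 3-decomposable halfperiod `Π` on `n` points (with `3 ∣ n`) and `1 ≤ k < n/2`,
the number of `(≤ k)`-critical transpositions of `Π` is at least `B(k,n)`. -/
theorem NcritLe_of_threeDecomposable_ge (n k s : ℕ) (hn : 0 < n) (h3 : 3 ∣ n)
    (hk1 : 1 ≤ k) (hk2 : 2 * k < n)
    (hs : 0 < s ∧ rbinom2 (s : ℝ) < (n : ℝ) / (3 * ((n : ℝ) - 2 * k - 1)) ∧
      (n : ℝ) / (3 * ((n : ℝ) - 2 * k - 1)) ≤ rbinom2 ((s : ℝ) + 1))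
    (H : Halfperiod n) (A B C : Finset (Fin n)) (hdec : H.ThreeDecomp A B C) :
    Bkn k n s ≤ (NcritLe n k H : ℝ) := by
  obtain ⟨hA, hB, hC, hAB, hAC, hBC, hU, hab, hbc, σ, τ, -, hστ, hτ, hba, hac, -, -⟩ := hdec
  obtain ⟨m, rfl⟩ := h3
  have hAm : A.card = m := by omega
  have hBm : B.card = m := by omega
  have hCm : C.card = m := by omega
  obtain ⟨a₀, ha₀⟩ : A.Nonempty := Finset.card_pos.1 (by omega)
  obtain ⟨b₀, hb₀⟩ : B.Nonempty := Finset.card_pos.1 (by omega)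
  have hcov : ∀ x, x ∈ A ∨ x ∈ B ∨ x ∈ C := by
    intro x
    have := Finset.mem_univ x
    rw [← hU] at this
    simpa [or_assoc] using this
  have hAseg : A = H.initSeg 0 m := by
    refine H.eq_initSeg hAm fun x hx y hy => ?_
    rcases hcov y with h | h | h
    · exact absurd h hy
    · exact hab x hx y h
    · exact (hab x hx b₀ hb₀).trans (hbc b₀ hb₀ y h)
  have hBseg : B = H.initSeg (σ + 1) m := by
    refine H.eq_initSeg hBm fun x hx y hy => ?_
    rcases hcov y with h | h | h
    · exact hba x hx y h
    · exact absurd h hy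
    · exact (hba x hx a₀ ha₀).trans (hac a₀ ha₀ y h)
  have hCseg : C = H.initSeg ((3 * m).choose 2) m := by
    refine H.eq_initSeg hCm fun x hx y hy => ?_
    have hlt : H.pos 0 y < H.pos 0 x := by
      rcases hcov y with h | h | h
      · exact (hab y h b₀ hb₀).trans (hbc b₀ hb₀ x hx)
      · exact hbc y h x hx
      · exact absurd h hy
    have h1 := H.reverse x
    have h2 := H.reverse y
    have h3 := Fin.lt_def.1 hlt
    have h4 := (H.pos 0 x).isLt
    rw [Fin.lt_def]
    omega
  have hN : 2 * (NcritLe (3 * m) k H : ℤ) =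
      (H.critPairs k A A + H.critPairs k A Aᶜ) + (H.critPairs k B B + H.critPairs k B Bᶜ) +
      (H.critPairs k C C + H.critPairs k C Cᶜ) := by
    rw [← H.critPairs_univ k, ← H.critPairs_univ_right k A, ← H.critPairs_univ_right k B,
      ← H.critPairs_univ_right k C, ← H.critPairs_union_left k _ hAB,
      ← H.critPairs_union_left k _ (Finset.disjoint_union_left.2 ⟨hAC, hBC⟩), hU]
  have hσ : σ + 1 ≤ (3 * m).choose 2 := by omega
  rcases lt_or_ge k m with hkm | hkm
  · have hcut : ∀ T ≤ (3 * m).choose 2,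
        (k : ℤ) * (k + 1) ≤ H.critPairs k (H.initSeg T m) (H.initSeg T m)ᶜ := fun T hT =>
      H.critPairs_initSeg_compl_of_ge hk2 hT hkm.le (by omega)
    have h1 := hcut 0 (Nat.zero_le _)
    have h2 := hcut _ hσ
    have h3 := hcut _ le_rfl
    rw [← hAseg] at h1
    rw [← hBseg] at h2
    rw [← hCseg] at h3
    have h4 := H.critPairs_nonneg k A A
    have h5 := H.critPairs_nonneg k B B
    have h6 := H.critPairs_nonneg k C C
    have h7 : 3 * ((k : ℤ) * (k + 1)) ≤ 2 * (NcritLe (3 * m) k H : ℤ) := by linarith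
    have h8 : 3 * ((k : ℝ) * (k + 1)) ≤ 2 * (NcritLe (3 * m) k H : ℝ) := by exact_mod_cast h7
    rw [Bkn_of_lt s hkm]
    linarith
  · obtain ⟨w, hw⟩ : ∃ w, w + 2 * k + 1 = 3 * m := ⟨3 * m - 2 * k - 1, by omega⟩
    have hwR : (w : ℝ) = 3 * m - 1 - 2 * k := by
      have : (w : ℝ) + 2 * k + 1 = 3 * m := by exact_mod_cast hw
      linarith
    have hwm : (w : ℝ) + 1 ≤ m := by
      have : w + 1 ≤ m := by omega
      exact_mod_cast this
    obtain ⟨L, hL1, hL, hsum⟩ := exists_sum_le_chainBound hwm (by positivity) (s - 1)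
    have hLm : (w : ℝ) * (L * (L + 1)) / 2 ≤ m := by
      have hpos : (0 : ℝ) < L * (L + 1) := by
        have : (1 : ℝ) ≤ L := by exact_mod_cast hL1
        positivity
      have : (w : ℝ) / 2 ≤ m / (L * (L + 1)) := by linarith
      rw [le_div_iff₀ hpos] at this
      linarith
    have hcut : ∀ T ≤ (3 * m).choose 2,
        (m : ℤ) * (2 * k + 1 - m) ≤ H.critPairs k (H.initSeg T m) (H.initSeg T m)ᶜ :=
      fun T hT => H.critPairs_initSeg_compl_of_le hk2 hT hkm
    have hself : ∀ T ≤ (3 * m).choose 2,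
        2 * chainBound w L m ≤ H.critPairs k (H.initSeg T m) (H.initSeg T m) := fun T hT =>
      H.two_mul_chainBound_le hw hT hkm (by omega) hLm
    have h1 := hcut 0 (Nat.zero_le _)
    have h2 := hcut _ hσ
    have h3 := hcut _ le_rfl
    have h4 := hself 0 (Nat.zero_le _)
    have h5 := hself _ hσ
    have h6 := hself _ le_rfl
    rw [← hAseg] at h1 h4
    rw [← hBseg] at h2 h5
    rw [← hCseg] at h3 h6
    have hNR : 2 * (NcritLe (3 * m) k H : ℝ) =
        ((H.critPairs k A A : ℝ) + H.critPairs k A Aᶜ) +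
        (H.critPairs k B B + H.critPairs k B Bᶜ) +
        (H.critPairs k C C + H.critPairs k C Cᶜ) := by exact_mod_cast hN
    have h1' : (m : ℝ) * (2 * k + 1 - m) ≤ H.critPairs k A Aᶜ := by exact_mod_cast h1
    have h2' : (m : ℝ) * (2 * k + 1 - m) ≤ H.critPairs k B Bᶜ := by exact_mod_cast h2
    have h3' : (m : ℝ) * (2 * k + 1 - m) ≤ H.critPairs k C Cᶜ := by exact_mod_cast h3
    rw [Bkn_of_ge s hkm, ← hwR]
    have hone : (m : ℝ) * (2 * k + 1 - m) / 2 + chainBound w 1 m =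
        (k + 1) * k / 2 + (k - m + 1) * (k - m) / 2 := by
      rw [chainBound, hwR]
      push_cast
      ring
    linarith
end
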